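/- arXiv:1802.01757 — 3 statements merged into one kernel-verified Lean document; each statement's English description precedes it below -/
import Mathlib

section
/- Let p and q be primes and let D = ℤ/p ⋊ ℤ/q^n (n ≥ 1) be a semidirect product in which the generator t of ℤ/q^n acts on ℤ/p by an automorphism of order exactly q (so that D is minimal non-abelian). Then the integral group cohomology of D with trivial coefficients satisfies: H^0(D;ℤ) ≅ ℤ; H^i(D;ℤ) = 0 for all odd i; H^i(D;ℤ) ≅ ℤ/q^n for all even i > 0 not divisible by 2q; and H^i(D;ℤ) ≅ ℤ/p ⊕ ℤ/q^n for all i > 0 divisible by 2q. -/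
section CyclicNormalComplementCohomology

open CategoryTheory

section ZModSums

open Polynomial

variable {p : ℕ} [Fact p.Prime]

lemma ZMod.sum_inv_eq_zero (hp : p ≠ 2) : ∑ a : ZMod p, a⁻¹ = 0 := by
  have h2 : (2 : ZMod p) ≠ 0 := by
    exact Ring.two_ne_zero (by rwa [ZMod.ringChar_zmod_n])
  have h : ∑ a : ZMod p, a⁻¹ = -∑ a : ZMod p, a⁻¹ := by
    rw [← Finset.sum_neg_distrib, ← Equiv.sum_comp (Equiv.neg (ZMod p))]
    simp [inv_neg]
  have h3 : (2 : ZMod p) * ∑ a : ZMod p, a⁻¹ = 0 := by linear_combination h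
  exact (mul_eq_zero.mp h3).resolve_left h2

lemma ZMod.sum_mul_inv : ∑ a : ZMod p, a * a⁻¹ = -1 := by
  have h : ∀ a : ZMod p, a * a⁻¹ = 1 - if a = 0 then 1 else 0 := fun a => by
    split_ifs with ha <;> simp [ha]
  simp [h, ZMod.card]

/-- A function on `ZMod p` all of whose convolutions with `a ↦ a⁻¹` vanish is constant. -/
lemma ZMod.eq_zero_apply_of_sum_inv_mul_eq_zero (hp : p ≠ 2) (h : ZMod p → ZMod p)
    (H : ∀ b, ∑ a, a⁻¹ * h (a + b) = 0) (b : ZMod p) : h b = h 0 := by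
  let T : Module.End (ZMod p) (ZMod p → ZMod p) := LinearMap.funLeft _ _ (· + 1)
  have hT : ∀ (n : ℕ) (f : ZMod p → ZMod p) (c : ZMod p), (T ^ n) f c = f (c + n) := by
    intro n
    induction n with
    | zero => simp
    | succ n ih => intro f c; rw [pow_succ, Module.End.mul_apply, ih]; simp [T, add_assoc]
  let Y : (ZMod p)[X] := ∑ a : ZMod p, C a⁻¹ * X ^ a.val
  have hY : aeval T Y h = 0 := by
    funext c
    simpa [Y, hT, add_comm] using H c
  have hXp : aeval T ((X - 1 : (ZMod p)[X]) ^ p) = 0 := by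
    rw [sub_pow_char, one_pow, map_sub, map_pow, aeval_X, map_one, sub_eq_zero]
    ext f c
    simp [hT]
  have hY1 : Y.eval 1 = 0 := by simp [Y, eval_finsetSum, ZMod.sum_inv_eq_zero hp]
  have hY2 : (derivative Y).eval 1 = -1 := by
    rw [derivative_sum, eval_finsetSum, ← ZMod.sum_mul_inv]
    refine Finset.sum_congr rfl fun a _ => ?_
    rw [derivative_C_mul_X_pow, eval_C_mul, eval_pow, eval_X, one_pow, mul_one,
      ZMod.natCast_zmod_val, mul_comm]
  obtain ⟨U, hU⟩ := dvd_iff_isRoot.mpr hY1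
  have hU1 : U.eval 1 = -1 := by
    rw [← hY2, hU]; simp
  have hcop : IsCoprime U ((X - 1 : (ZMod p)[X]) ^ (p - 1)) := by
    refine IsCoprime.pow_right ?_
    rw [← C_1]
    refine ((Polynomial.irreducible_X_sub_C (1 : ZMod p)).coprime_iff_not_dvd.mpr ?_).symm
    rw [dvd_iff_isRoot, IsRoot, hU1]
    simp
  obtain ⟨u, v, huv⟩ := hcop
  have hk : (X - 1 : (ZMod p)[X]) = u * Y + v * (X - 1) ^ p := by
    have hpow : (X - 1 : (ZMod p)[X]) ^ p = (X - 1) ^ (p - 1) * (X - 1) := by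
      rw [← pow_succ, Nat.sub_add_cancel (Fact.out : p.Prime).one_le]
    rw [hU, hpow, C_1]
    linear_combination (-(X - 1 : (ZMod p)[X])) * huv
  have hTh : T h = h := by
    have := congrArg (fun P => aeval T P h) hk
    simpa [-map_pow, hXp, hY, sub_eq_zero] using this
  have : ∀ n : ℕ, (T ^ n) h = h := fun n => by
    induction n with
    | zero => rfl
    | succ n ih => rw [pow_succ, Module.End.mul_apply, hTh, ih]
  have hb := hT b.val h 0
  rw [this, zero_add, ZMod.natCast_zmod_val] at hb
  exact hb.symm

end ZModSums

/-- A normal subgroup of prime order `p` complementing the subgroup `S`, parametrised by `ZMod p`,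
together with the character through which the ambient group acts on it by conjugation. -/
structure CyclicNormalComplement {G : Type} [Group G] (S : Subgroup G) (p : ℕ) where
  /-- The parametrisation of the normal complement. -/
  elt : ZMod p → G
  /-- The character giving the conjugation action. -/
  χ : G →* (ZMod p)ˣ
  elt_add : ∀ a b, elt (a + b) = elt a * elt b
  mul_elt : ∀ g a, g * elt a = elt (χ g * a) * g
  exists_mul_elt : ∀ g, ∃ s ∈ S, ∃ a, g = s * elt a
  eq_zero_of_mem : ∀ a, elt a ∈ S → a = 0

namespace CyclicNormalComplement

variable {G : Type} [Group G] {S : Subgroup G} {p : ℕ} (C : CyclicNormalComplement S p)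

lemma elt_zero : C.elt 0 = 1 := by
  simpa using C.elt_add 0 0

lemma χ_elt (a : ZMod p) : C.χ (C.elt a) = 1 := by
  have h := C.mul_elt (C.elt a) 1
  rw [← C.elt_add, ← C.elt_add, add_comm] at h
  have h' := C.eq_zero_of_mem ((C.χ (C.elt a) * 1 + a) - (1 + a)) (by
    have h2 := C.elt_add ((C.χ (C.elt a) * 1 + a) - (1 + a)) (1 + a)
    rw [sub_add_cancel, ← h] at h2
    rw [mul_eq_right.mp h2.symm]; exact S.one_mem)
  ext
  simpa [sub_eq_zero] using h'

variable {k : Type} [CommRing k] (A : Rep.{0} k G)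

/-- The coinduction to `G` of the restriction to `S` of a representation of `G`. -/
noncomputable abbrev coindRes (S : Subgroup G) (A : Rep.{0} k G) : Rep.{0} k G :=
  Rep.coind S.subtype (Rep.res S.subtype A)

lemma coindRes_apply_mul (f : coindRes S A) {s : G} (hs : s ∈ S) (g : G) :
    f.1 (s * g) = A.ρ s (f.1 g) :=
  f.2 ⟨s, hs⟩ g

lemma coindRes_ρ_apply (f : coindRes S A) (g h : G) :
    ((coindRes S A).ρ g f).1 h = f.1 (h * g) := rfl

/-- The unit `A ⟶ Coind (Res A)` of the restriction-coinduction adjunction. -/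
noncomputable def unit (S : Subgroup G) (A : Rep.{0} k G) : A ⟶ coindRes S A :=
  Rep.resCoindToHom S.subtype A (Rep.res S.subtype A) (𝟙 _)

lemma unit_apply (a : A) (g : G) : ((unit S A).hom a).1 g = A.ρ g a := rfl

lemma unit_injective : Function.Injective (unit S A).hom := fun a b h => by
  have h1 : A.ρ 1 a = A.ρ 1 b := congrArg (fun f : coindRes S A => f.1 1) h
  simpa using h1

variable {A}

lemma coindRes_ext {f f' : coindRes S A} (h : ∀ a, f.1 (C.elt a) = f'.1 (C.elt a)) : f = f' := by
  refine Subtype.ext (funext fun g => ?_)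
  obtain ⟨s, hs, a, rfl⟩ := C.exists_mul_elt g
  rw [coindRes_apply_mul A f hs, coindRes_apply_mul A f' hs, h]

lemma ρ_mul_elt (hA : ∀ a, A.ρ (C.elt a) = 1) (g : G) (a : ZMod p) :
    A.ρ (g * C.elt a) = A.ρ g := by
  rw [map_mul, hA, mul_one]

variable [Fact p.Prime]

lemma sum_mul_elt (f : coindRes S A) (hA : ∀ a, A.ρ (C.elt a) = 1) (g : G) :
    ∑ a, f.1 (C.elt a * g) = A.ρ g (∑ a, f.1 (C.elt a)) := by
  obtain ⟨s, hs, b, rfl⟩ := C.exists_mul_elt g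
  rw [C.ρ_mul_elt hA, map_sum, ← Equiv.sum_comp (C.χ s).mulLeft,
    ← Equiv.sum_comp (Equiv.addRight b) fun a => A.ρ s (f.1 (C.elt a))]
  refine Finset.sum_congr rfl fun a _ => ?_
  rw [Units.mulLeft_apply, ← mul_assoc, ← C.mul_elt, mul_assoc, ← C.elt_add,
    coindRes_apply_mul A f hs, Equiv.coe_addRight]

/-- The trace `Coind (Res A) ⟶ A`, for `A` a representation on which the normal complement
of `S` acts trivially. -/
noncomputable def trace (hA : ∀ a, A.ρ (C.elt a) = 1) : coindRes S A ⟶ A :=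
  Rep.ofHom
    { toFun f := ∑ a, f.1 (C.elt a)
      map_add' f f' := by simp [Finset.sum_add_distrib]
      map_smul' r f := by simp [Finset.smul_sum]
      isIntertwining' g := LinearMap.ext fun f => C.sum_mul_elt f hA g }

lemma unit_comp_trace (hA : ∀ a, A.ρ (C.elt a) = 1) :
    unit S A ≫ C.trace hA = (p : ℤ) • 𝟙 A := by
  refine Rep.hom_ext (Representation.IntertwiningMap.ext (LinearMap.ext fun a => ?_))
  change ∑ b, A.ρ (C.elt b) a = (p : ℤ) • a
  simp [hA, ZMod.card]

/-- The representation of `G` on `ZMod p` given by a character, as a homomorphism. -/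
def charRepresentation (k : Type) [CommRing k] [Algebra k (ZMod p)] (c : G →* (ZMod p)ˣ) :
    Representation k G (ZMod p) where
  toFun g := LinearMap.mulLeft k (c g : ZMod p)
  map_one' := by ext; simp
  map_mul' g h := by ext; simp

/-- The representation of `G` on `ZMod p` given by a character. -/
noncomputable abbrev charRep (k : Type) [CommRing k] [Algebra k (ZMod p)]
    (c : G →* (ZMod p)ˣ) : Rep.{0} k G :=
  Rep.of (charRepresentation k c)

variable (k) [Algebra k (ZMod p)] (c : G →* (ZMod p)ˣ)

lemma charRep_ρ_apply (g : G) (v : ZMod p) : charRepresentation k c g v = c g * v := rfl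

variable {c} in
lemma charRep_ρ_elt (hc : ∀ a, c (C.elt a) = 1) (a : ZMod p) :
    (charRep k c).ρ (C.elt a) = 1 :=
  LinearMap.ext fun v => by rw [charRep_ρ_apply, hc]; exact one_mul v

variable {k c} in
/-- A function in a coinduced character, as a function with values in `ZMod p`. -/
def coindFun (f : coindRes S (charRep k c)) (g : G) : ZMod p := f.1 g

variable {k c} in
lemma coindFun_mul (f : coindRes S (charRep k c)) {s : G} (hs : s ∈ S) (g : G) :
    coindFun f (s * g) = c s * coindFun f g :=
  coindRes_apply_mul _ f hs g

/-- Convolution with `a ↦ a⁻¹`, as a map from the coinduction of `χ * c` to that of `c`. -/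
noncomputable def convInv :
    coindRes S (charRep k (C.χ * c)) ⟶ coindRes S (charRep k c) :=
  Rep.ofHom
    { toFun f := ⟨fun g => (∑ a : ZMod p, a⁻¹ * coindFun f (C.elt a * g) : ZMod p), fun s g => by
        change ∑ a, a⁻¹ * coindFun f (C.elt a * (s * g)) =
          c s * ∑ a, a⁻¹ * coindFun f (C.elt a * g)
        rw [← Equiv.sum_comp (C.χ s).mulLeft, Finset.mul_sum]
        refine Finset.sum_congr rfl fun a _ => ?_
        rw [Units.mulLeft_apply, ← mul_assoc, ← C.mul_elt, mul_assoc, coindFun_mul f s.2,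
          mul_inv, MonoidHom.mul_apply, Units.val_mul]
        have : (C.χ s : ZMod p) ≠ 0 := (C.χ s).ne_zero
        field_simp⟩
      map_add' f f' := Subtype.ext <| funext fun g => by
        change ∑ a, a⁻¹ * (coindFun f (C.elt a * g) + coindFun f' (C.elt a * g)) =
          ∑ a, a⁻¹ * coindFun f (C.elt a * g) + ∑ a, a⁻¹ * coindFun f' (C.elt a * g)
        simp [mul_add, Finset.sum_add_distrib]
      map_smul' r f := Subtype.ext <| funext fun g => by
        change ∑ a, a⁻¹ * (r • coindFun f (C.elt a * g)) =
          r • ∑ a, a⁻¹ * coindFun f (C.elt a * g)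
        simp [Finset.smul_sum]
      isIntertwining' g := LinearMap.ext fun f => Subtype.ext <| funext fun h => by
        change ∑ a, a⁻¹ * coindFun f (C.elt a * h * g) = ∑ a, a⁻¹ * coindFun f (C.elt a * (h * g))
        simp [mul_assoc] }

lemma convInv_apply (f : coindRes S (charRep k (C.χ * c))) (g : G) :
    coindFun ((C.convInv k c).hom f) g = ∑ a : ZMod p, a⁻¹ * coindFun f (C.elt a * g) := rfl

variable {c}

lemma exact_unit_convInv (hp : p ≠ 2) (hc : ∀ a, c (C.elt a) = 1) :
    Function.Exact (unit S (charRep k (C.χ * c))).hom (C.convInv k c).hom := by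
  have hc' : ∀ a, (C.χ * c) (C.elt a) = 1 := fun a => by
    rw [MonoidHom.mul_apply, C.χ_elt, hc, one_mul]
  intro f
  constructor
  · intro h
    refine ⟨(coindFun f 1 : ZMod p), C.coindRes_ext fun a => ?_⟩
    have hf := ZMod.eq_zero_apply_of_sum_inv_mul_eq_zero hp (fun a => coindFun f (C.elt a))
      (fun b => by
        simp_rw [C.elt_add]
        rw [← convInv_apply, h]; rfl) a
    rw [unit_apply, C.charRep_ρ_elt k hc', Module.End.one_apply]
    rw [C.elt_zero] at hf
    exact hf.symm
  · rintro ⟨v, rfl⟩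
    refine C.coindRes_ext fun b => ?_
    change ∑ a : ZMod p, a⁻¹ * coindFun _ (C.elt a * C.elt b) = 0
    have : ∀ a, coindFun ((unit S (charRep k (C.χ * c))).hom v) (C.elt a * C.elt b) =
        (v : ZMod p) := fun a => by
        rw [← C.elt_add]
        exact congrArg (fun L => L v) (C.charRep_ρ_elt k hc' (a + b))
    simp_rw [this, ← Finset.sum_mul, ZMod.sum_inv_eq_zero hp, zero_mul]

lemma trace_surjective (hc : ∀ a, c (C.elt a) = 1) :
    Function.Surjective (C.trace (C.charRep_ρ_elt k hc)).hom := by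
  classical
  intro v
  let f : coindRes S (charRep k c) :=
    ⟨fun g => (if g ∈ S then c g * v else 0 : ZMod p), fun s g => by
      change (if (s : G) * g ∈ S then (c (s * g) * v : ZMod p) else 0) =
        c s * (if g ∈ S then (c g * v : ZMod p) else 0)
      rw [Subgroup.mul_mem_cancel_left S s.2]
      split_ifs <;> simp [mul_assoc]⟩
  refine ⟨f, ?_⟩
  change ∑ a, (if C.elt a ∈ S then (c (C.elt a) * v : ZMod p) else 0) = v
  rw [Finset.sum_eq_single 0]
  · simp [C.elt_zero, S.one_mem]
  · intro a _ ha
    rw [if_neg fun h => ha (C.eq_zero_of_mem a h)]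
  · simp

lemma card_coindRes_charRep (c c' : G →* (ZMod p)ˣ) :
    Nat.card (coindRes S (charRep k c)) = Nat.card (coindRes S (charRep k c')) := by
  have key : ∀ (c c' : G →* (ZMod p)ˣ) (f : coindRes S (charRep k c)),
      (fun g => (c' g * (c g)⁻¹ : (ZMod p)ˣ) * coindFun f g : G → ZMod p) ∈
        Representation.coindV S.subtype (Rep.res S.subtype (charRep k c')).ρ := by
    intro c c' f s g
    change ((c' (s * g) * (c (s * g))⁻¹ : (ZMod p)ˣ) : ZMod p) * coindFun f (s * g) =
      c' s * (((c' g * (c g)⁻¹ : (ZMod p)ˣ) : ZMod p) * coindFun f g)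
    rw [coindFun_mul f s.2]
    have h1 : (c s : ZMod p) ≠ 0 := (c s).ne_zero
    have h2 : (c g : ZMod p) ≠ 0 := (c g).ne_zero
    simp only [map_mul, mul_inv, Units.val_mul, Units.val_inv_eq_inv_val]
    field_simp
  refine Nat.card_congr ⟨fun f => ⟨_, key c c' f⟩, fun f => ⟨_, key c' c f⟩, fun f => ?_,
    fun f => ?_⟩
  · refine Subtype.ext (funext fun g => ?_)
    change (c g * (c' g)⁻¹ : (ZMod p)ˣ) * ((c' g * (c g)⁻¹ : (ZMod p)ˣ) * coindFun f g) =
      coindFun f g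
    rw [← mul_assoc, ← Units.val_mul]
    simp
  · refine Subtype.ext (funext fun g => ?_)
    change (c' g * (c g)⁻¹ : (ZMod p)ˣ) * ((c g * (c' g)⁻¹ : (ZMod p)ˣ) * coindFun f g) =
      coindFun f g
    rw [← mul_assoc, ← Units.val_mul]
    simp

lemma exact_convInv_trace [Finite G] (hp : p ≠ 2) (hc : ∀ a, c (C.elt a) = 1) :
    Function.Exact (C.convInv k c).hom (C.trace (C.charRep_ρ_elt k hc)).hom := by
  let U := (unit S (charRep k (C.χ * c))).hom.toLinearMap.toAddMonoidHom
  let F := (C.convInv k c).hom.toLinearMap.toAddMonoidHom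
  let T := (C.trace (C.charRep_ρ_elt k hc)).hom.toLinearMap.toAddMonoidHom
  have : Finite (coindRes S (charRep k c)) :=
    Finite.of_injective (fun f => coindFun f) fun f f' h => Subtype.ext h
  have hle : F.range ≤ T.ker := by
    rintro _ ⟨f, rfl⟩
    change ∑ b, ∑ a : ZMod p, a⁻¹ * coindFun f (C.elt a * C.elt b) = 0
    have : ∀ a, ∑ b, a⁻¹ * coindFun f (C.elt a * C.elt b) =
        a⁻¹ * ∑ b, coindFun f (C.elt b) := fun a => by
      simp_rw [← C.elt_add]
      rw [← Finset.mul_sum, ← Equiv.sum_comp (Equiv.addLeft a) fun b => coindFun f (C.elt b)]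
      rfl
    rw [Finset.sum_comm]
    simp_rw [this]
    rw [← Finset.sum_mul, ZMod.sum_inv_eq_zero hp, zero_mul]
  have hF : F.ker = U.range :=
    AddSubgroup.ext fun f => C.exact_unit_convInv k hp hc f
  have hU : Nat.card U.range = p := by
    rw [← Nat.card_congr (AddMonoidHom.ofInjective (f := U) (unit_injective _)).toEquiv]
    exact Nat.card_zmod p
  have hT : Nat.card T.range = p := by
    rw [AddMonoidHom.range_eq_top.mpr (C.trace_surjective k hc), AddSubgroup.card_top]
    exact Nat.card_zmod p
  have hcardF := F.ker.card_mul_index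
  have hcardT := T.ker.card_mul_index
  rw [AddSubgroup.index_ker, hF, hU, card_coindRes_charRep k _ c, ← hcardT,
    AddSubgroup.index_ker, hT, mul_comm] at hcardF
  have hrange : F.range = T.ker := AddSubgroup.eq_of_le_of_card_ge hle
    (Nat.eq_of_mul_eq_mul_right (Fact.out : p.Prime).pos hcardF).ge
  intro f
  exact (SetLike.ext_iff.mp hrange f).symm

end CyclicNormalComplement

namespace groupCohomology

open ShortComplex Limits

variable {k G : Type} [CommRing k] [Group G]

instance additive_functor (n : ℕ) : (functor k G n).Additive where
  map_add {A B f g} := by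
    change HomologicalComplex.homologyMap ((cochainsFunctor k G).map (f + g)) n = _
    rw [Functor.map_add, HomologicalComplex.homologyMap_add]
    rfl

lemma map_zsmul_id (A : Rep.{0} k G) (n : ℕ) (m : ℤ) (x : groupCohomology A n) :
    ((functor k G n).map (m • 𝟙 A)).hom x = m • x := by
  rw [Functor.map_zsmul, CategoryTheory.Functor.map_id]
  let e : (groupCohomology A n ⟶ groupCohomology A n) →+ groupCohomology A n :=
    { toFun f := f.hom x
      map_zero' := rfl
      map_add' _ _ := rfl }
  exact map_zsmul e m (𝟙 _)

lemma nonempty_equiv_zero {A B : Rep.{0} k G} (f : A ⟶ B) [Mono f]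
    (h : Function.Surjective ((functor k G 0).map f).hom) :
    Nonempty (groupCohomology A 0 ≃ₗ[k] groupCohomology B 0) :=
  ⟨LinearEquiv.ofBijective ((functor k G 0).map f).hom
    ⟨(ModuleCat.mono_iff_injective _).mp (mono_map_0_of_mono f), h⟩⟩

variable {X : ShortComplex (Rep.{0} k G)} (hX : X.ShortExact)

include hX

lemma exact_δ_map {i : ℕ} : Function.Exact (δ hX i (i + 1) rfl).hom
    ((functor k G (i + 1)).map X.f).hom :=
  (ShortComplex.ShortExact.moduleCat_exact_iff_function_exact _).mp (mapShortComplex₁_exact hX rfl)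

lemma exact_map_map {i : ℕ} : Function.Exact ((functor k G i).map X.f).hom
    ((functor k G i).map X.g).hom :=
  (ShortComplex.ShortExact.moduleCat_exact_iff_function_exact _).mp (mapShortComplex₂_exact hX i)

lemma exact_map_δ {i : ℕ} : Function.Exact ((functor k G i).map X.g).hom
    (δ hX i (i + 1) rfl).hom :=
  (ShortComplex.ShortExact.moduleCat_exact_iff_function_exact _).mp (mapShortComplex₃_exact hX rfl)

/-- Dimension shifting along a short exact sequence with middle term acyclic in one degree. -/
lemma nonempty_equiv_succ_of_map_eq_zero {i : ℕ}
    (h : (functor k G i).map X.g = 0) [Subsingleton (groupCohomology X.X₂ (i + 1))] :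
    Nonempty (groupCohomology X.X₃ i ≃ₗ[k] groupCohomology X.X₁ (i + 1)) := by
  refine ⟨LinearEquiv.ofBijective (δ hX i (i + 1) rfl).hom ⟨?_, ?_⟩⟩
  · rw [injective_iff_map_eq_zero]
    intro x hx
    obtain ⟨y, rfl⟩ := (exact_map_δ hX x).mp hx
    rw [h]; rfl
  · intro y
    exact (exact_δ_map hX y).mp (Subsingleton.elim (α := groupCohomology X.X₂ (i + 1)) _ _)

lemma nonempty_equiv_succ {i : ℕ} [Subsingleton (groupCohomology X.X₂ i)]
    [Subsingleton (groupCohomology X.X₂ (i + 1))] :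
    Nonempty (groupCohomology X.X₃ i ≃ₗ[k] groupCohomology X.X₁ (i + 1)) := by
  refine nonempty_equiv_succ_of_map_eq_zero hX ?_
  have := ModuleCat.isZero_of_subsingleton (groupCohomology X.X₂ i)
  exact this.eq_of_src _ _

lemma map_eq_zero_of_surjective {i : ℕ} (h : Function.Surjective ((functor k G i).map X.f).hom) :
    (functor k G i).map X.g = 0 := by
  refine ModuleCat.hom_ext (LinearMap.ext fun x => ?_)
  exact (exact_map_map hX x).mpr (h x)

lemma surjective_of_map_eq_zero {i : ℕ} (h : (functor k G i).map X.g = 0) :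
    Function.Surjective ((functor k G i).map X.f).hom := fun x =>
  (exact_map_map hX x).mp (by rw [h]; rfl)

end groupCohomology

namespace CategoryTheory

/-- A four-term exact sequence is spliced from two short exact sequences. -/
lemma exists_shortExact_of_exact {𝒜 : Type*} [Category* 𝒜] [Abelian 𝒜] {A B C D : 𝒜}
    (f : A ⟶ B) (y : B ⟶ C) (g : C ⟶ D) [Mono f] [Epi g] (hfy : f ≫ y = 0) (hyg : y ≫ g = 0)
    (h1 : (ShortComplex.mk f y hfy).Exact) (h2 : (ShortComplex.mk y g hyg).Exact) :
    ∃ (W : 𝒜) (u : B ⟶ W) (v : W ⟶ C) (hu : f ≫ u = 0) (hv : v ≫ g = 0),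
      (ShortComplex.mk f u hu).ShortExact ∧ (ShortComplex.mk v g hv).ShortExact := by
  have hlift : f ≫ Limits.kernel.lift g y hyg = 0 := by
    rw [← cancel_mono (Limits.kernel.ι g)]; simp [hfy]
  refine ⟨Limits.kernel g, Limits.kernel.lift g y hyg, Limits.kernel.ι g, hlift,
    Limits.kernel.condition g, ?_, ?_⟩
  · have : Epi (Limits.kernel.lift g y hyg) := h2.epi_kernelLift
    let φ : ShortComplex.mk f (Limits.kernel.lift g y hyg) hlift ⟶ ShortComplex.mk f y hfy :=
      { τ₁ := 𝟙 _
        τ₂ := 𝟙 _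
        τ₃ := Limits.kernel.ι g }
    have : Epi φ.τ₁ := inferInstanceAs (Epi (𝟙 A))
    have : IsIso φ.τ₂ := inferInstanceAs (IsIso (𝟙 B))
    have : Mono φ.τ₃ := inferInstanceAs (Mono (Limits.kernel.ι g))
    exact ShortComplex.ShortExact.mk ((ShortComplex.exact_iff_of_epi_of_isIso_of_mono φ).mpr h1)
  · exact ShortComplex.ShortExact.mk (ShortComplex.exact_kernel g)

end CategoryTheory

namespace Rep.FiniteCyclicGroup

variable {k G : Type} [CommRing k] [CommGroup G] [Fintype G] (A : Rep.{0} k G) (g : G)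
  (hg : ∀ x, x ∈ Subgroup.zpowers g)

lemma groupCohomologyπEven_surjective (i : ℕ) [NeZero i] (hi : Even i) :
    Function.Surjective (groupCohomologyπEven A g hg i hi) :=
  (ModuleCat.epi_iff_surjective _).mp (epi_comp'
    (@IsIso.epi_of_iso _ _ _ _ _ (normHomCompSub A g).moduleCatCyclesIso.isIso_inv)
    (epi_comp' inferInstance inferInstance))

lemma groupCohomologyπOdd_surjective (i : ℕ) (hi : Odd i) :
    Function.Surjective (groupCohomologyπOdd A g hg i hi) :=
  (ModuleCat.epi_iff_surjective _).mp (epi_comp'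
    (@IsIso.epi_of_iso _ _ _ _ _ (subCompNormHom A g).moduleCatCyclesIso.isIso_inv)
    (epi_comp' inferInstance inferInstance))

end Rep.FiniteCyclicGroup

namespace groupCohomology

open Rep.FiniteCyclicGroup

variable {k H : Type} [CommRing k] [Group H] [Finite H] [IsCyclic H]

/-- The cohomology of a finite cyclic group in positive degrees is annihilated by its order. -/
lemma card_nsmul_eq_zero (A : Rep.{0} k H) {i : ℕ} (hi : i ≠ 0) (x : groupCohomology A i) :
    Nat.card H • x = 0 := by
  let : CommGroup H := IsCyclic.commGroup
  let := Fintype.ofFinite H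
  have : NeZero i := ⟨hi⟩
  obtain ⟨g, hg⟩ := IsCyclic.exists_generator (α := H)
  rcases Nat.even_or_odd i with he | ho
  · obtain ⟨y, rfl⟩ := groupCohomologyπEven_surjective A g hg i he x
    rw [← map_nsmul]
    refine (groupCohomologyπEven_eq_zero_iff A g hg i he _).mpr ⟨y.1, ?_⟩
    have hy : A.ρ g y.1 = y.1 := sub_eq_zero.mp y.2
    have hy' : y.1 ∈ A.ρ.invariants :=
      (Representation.mem_invariants_iff_of_forall_mem_zpowers A.ρ g hg _).mpr hy
    change A.ρ.norm y.1 = Nat.card H • y.1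
    simp [Representation.norm, hy' _]
  · obtain ⟨y, rfl⟩ := groupCohomologyπOdd_surjective A g hg i ho x
    rw [← map_nsmul]
    refine (groupCohomologyπOdd_eq_zero_iff A g hg i ho _).mpr ?_
    have hy : A.ρ.norm y.1 = 0 := y.2
    have key : Nat.card H • y.1 = -∑ h, (A.ρ h y.1 - y.1) := by
      simp only [Representation.norm, LinearMap.sum_apply] at hy
      simp [Finset.sum_sub_distrib, hy]
    change Nat.card H • y.1 ∈ _
    rw [key]
    refine Submodule.neg_mem _ (Submodule.sum_mem _ fun h _ => ?_)
    obtain ⟨n, rfl⟩ := (mem_powers_iff_mem_zpowers.mpr (hg h))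
    clear * -
    dsimp only
    induction n with
    | zero => simp
    | succ n ih =>
      have : A.ρ (g ^ (n + 1)) y.1 - y.1 =
          (A.ρ g (A.ρ (g ^ n) y.1) - A.ρ (g ^ n) y.1) + (A.ρ (g ^ n) y.1 - y.1) := by
        rw [pow_succ', map_mul]; simp
      rw [this]
      exact Submodule.add_mem _ ⟨A.ρ (g ^ n) y.1, rfl⟩ ih

lemma subsingleton_trivial_int_of_odd {i : ℕ} (hi : Odd i) :
    Subsingleton (groupCohomology (Rep.trivial ℤ H ℤ) i) := by
  let : CommGroup H := IsCyclic.commGroup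
  let := Fintype.ofFinite H
  obtain ⟨g, hg⟩ := IsCyclic.exists_generator (α := H)
  refine subsingleton_of_forall_eq 0 fun x => ?_
  obtain ⟨y, rfl⟩ := groupCohomologyπOdd_surjective (Rep.trivial ℤ H ℤ) g hg i hi x
  have hy : ∑ h : H, (Rep.trivial ℤ H ℤ).ρ h y.1 = 0 := by
    rw [← LinearMap.sum_apply]; exact y.2
  have hy' : Fintype.card H • y.1 = 0 := by
    rw [← hy, ← Finset.card_univ, ← Finset.sum_const]; rfl
  have : y = 0 := Subtype.ext ((smul_eq_zero (R := ℕ) (M := ℤ)).mp hy' |>.resolve_left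
    Fintype.card_ne_zero)
  rw [this, map_zero]

lemma nonempty_trivial_int_addEquiv {i : ℕ} (hi : i ≠ 0) (he : Even i) :
    Nonempty (ZMod (Nat.card H) ≃+ groupCohomology (Rep.trivial ℤ H ℤ) i) := by
  let : CommGroup H := IsCyclic.commGroup
  let := Fintype.ofFinite H
  have : NeZero i := ⟨hi⟩
  obtain ⟨g, hg⟩ := IsCyclic.exists_generator (α := H)
  let A := Rep.trivial ℤ H ℤ
  let f : ℤ →+ groupCohomology A i :=
    (groupCohomologyπEven A g hg i he).hom.toAddMonoidHom.comp
      { toFun m := ⟨m, sub_self (G := ℤ) m⟩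
        map_zero' := rfl
        map_add' _ _ := rfl }
  have hf : Function.Surjective f := fun x => by
    obtain ⟨y, rfl⟩ := groupCohomologyπEven_surjective A g hg i he x
    exact ⟨y.1, rfl⟩
  have hk : f.ker = AddSubgroup.zmultiples (Nat.card H : ℤ) := by
    ext m
    refine (groupCohomologyπEven_eq_zero_iff A g hg i he _).trans ?_
    have hnorm : ∀ m : ℤ, A.ρ.norm m = m * Nat.card H := fun m => by
      rw [Representation.norm, LinearMap.sum_apply]
      change ∑ _ : H, m = _
      simp [mul_comm]
    rw [AddSubgroup.mem_zmultiples_iff]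
    refine exists_congr fun l => ?_
    change A.ρ.norm l = m ↔ _
    rw [hnorm]; rfl
  exact ⟨(Int.quotientZMultiplesNatEquivZMod _).symm.trans
    ((QuotientAddGroup.quotientAddEquivOfEq hk.symm).trans
      (QuotientAddGroup.quotientKerEquivOfSurjective f hf))⟩

end groupCohomology

namespace Rep

variable {k G : Type} [CommRing k] [Group G]

lemma exact_of_function_exact (X : ShortComplex (Rep.{0} k G))
    (h : Function.Exact X.f.hom X.g.hom) : X.Exact := by
  rw [← ShortComplex.exact_map_iff_of_faithful X (forget₂ (Rep k G) (ModuleCat k)),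
    ShortComplex.ShortExact.moduleCat_exact_iff_function_exact]
  exact h

end Rep

namespace groupCohomology

variable {k G : Type} [CommRing k] [Group G]

lemma nsmul_eq_zero (A : Rep.{0} k G) {m : ℕ} (hA : ∀ a : A, m • a = 0) (i : ℕ)
    (x : groupCohomology A i) : m • x = 0 := by
  rw [← natCast_zsmul, ← map_zsmul_id]
  have : (m : ℤ) • 𝟙 A = 0 := by
    refine Rep.hom_ext (Representation.IntertwiningMap.ext (LinearMap.ext fun a => ?_))
    change (m : ℤ) • a = 0
    rw [natCast_zsmul, hA]
  rw [this, Functor.map_zero]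
  rfl

lemma eq_zero_of_coprime_nsmul {M : Type*} [AddCommGroup M] {a b : ℕ} (hab : a.Coprime b) {x : M}
    (ha : a • x = 0) (hb : b • x = 0) : x = 0 := by
  rw [← AddMonoid.addOrderOf_eq_one_iff]
  exact Nat.eq_one_of_dvd_coprimes hab (addOrderOf_dvd_of_nsmul_eq_zero ha)
    (addOrderOf_dvd_of_nsmul_eq_zero hb)

lemma subsingleton_of_coprime [Finite G] [IsCyclic G] (A : Rep.{0} k G) {m : ℕ}
    (hm : (Nat.card G).Coprime m) (hA : ∀ a : A, m • a = 0) {i : ℕ} (hi : i ≠ 0) :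
    Subsingleton (groupCohomology A i) :=
  subsingleton_of_forall_eq 0 fun x =>
    eq_zero_of_coprime_nsmul hm (card_nsmul_eq_zero A hi x) (nsmul_eq_zero A hA i x)

lemma map_zero_surjective {A B : Rep.{0} k G} (f : A ⟶ B)
    (h : ∀ b ∈ B.ρ.invariants, ∃ a ∈ A.ρ.invariants, f.hom a = b) :
    Function.Surjective ((functor k G 0).map f).hom := by
  intro y
  obtain ⟨a, ha, hab⟩ := h _ ((H0Iso B).hom y).2
  refine ⟨(H0Iso A).inv ⟨a, ha⟩, (ModuleCat.mono_iff_injective (H0Iso B).hom).mp inferInstance ?_⟩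
  have := congrArg (fun F => F.hom ((H0Iso A).inv ⟨a, ha⟩)) (map_id_comp_H0Iso_hom f)
  refine this.trans (Subtype.ext ?_)
  rw [ModuleCat.hom_comp, LinearMap.comp_apply, ← hab]
  simp
  rfl

end groupCohomology

namespace CyclicNormalComplement

open groupCohomology

variable {G : Type} [Group G] {S : Subgroup G} {p : ℕ} (C : CyclicNormalComplement S p)
  {k : Type} [CommRing k]

/-- Shapiro's lemma for the coinduction of the restriction of a representation of `G`. -/
noncomputable def coindResIso (A : Rep.{0} k G) (i : ℕ) :
    groupCohomology (coindRes S A) i ≃ₗ[k] groupCohomology (Rep.res S.subtype A) i :=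
  (coindIso (Rep.res S.subtype A) i).toLinearEquiv

lemma subsingleton_coindRes [Finite S] [IsCyclic S] (hS : (Nat.card S).Coprime p)
    (A : Rep.{0} k G) (hA : ∀ a : A, p • a = 0) {i : ℕ} (hi : i ≠ 0) :
    Subsingleton (groupCohomology (coindRes S A) i) :=
  have := subsingleton_of_coprime (Rep.res S.subtype A) hS hA hi
  (coindResIso A i).toEquiv.subsingleton

lemma map_zero_unit_surjective {A : Rep.{0} k G} (hA : ∀ a, A.ρ (C.elt a) = 1) :
    Function.Surjective ((functor k G 0).map (unit S A)).hom := by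
  refine map_zero_surjective _ fun f hf => ?_
  have hconst : ∀ g, f.1 g = f.1 1 := fun g => by
    have := congrArg (fun f : coindRes S A => f.1 1) (hf g)
    rwa [coindRes_ρ_apply, one_mul] at this
  have hinv : ∀ g, A.ρ g (f.1 1) = f.1 1 := fun g => by
    obtain ⟨s, hs, a, rfl⟩ := C.exists_mul_elt g
    rw [C.ρ_mul_elt hA, ← coindRes_apply_mul A f hs, hconst]
  exact ⟨f.1 1, hinv, Subtype.ext (funext fun g => (hinv g).trans (hconst g).symm)⟩

variable [Fact p.Prime]

lemma map_zero_trace {A : Rep.{0} k G} (hA : ∀ a, A.ρ (C.elt a) = 1) (hp : ∀ a : A, p • a = 0) :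
    (functor k G 0).map (C.trace hA) = 0 := by
  refine ModuleCat.hom_ext (LinearMap.ext fun y => ?_)
  obtain ⟨x, rfl⟩ := C.map_zero_unit_surjective hA y
  rw [← LinearMap.comp_apply, ← ModuleCat.hom_comp, ← Functor.map_comp, C.unit_comp_trace]
  refine (map_zsmul_id A 0 p x).trans ?_
  exact (natCast_zsmul _ _).trans (nsmul_eq_zero A hp 0 x)

variable [Algebra k (ZMod p)] {c : G →* (ZMod p)ˣ}

/-- The cohomology of the characters of `G` is periodic up to a twist. -/
lemma nonempty_equiv_add_two [Finite G] [IsCyclic S] (hS : (Nat.card S).Coprime p) (hp : p ≠ 2)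
    (hc : ∀ a, c (C.elt a) = 1) (i : ℕ) :
    Nonempty (groupCohomology (charRep k c) i ≃ₗ[k]
      groupCohomology (charRep k (C.χ * c)) (i + 2)) ∧
    Nonempty (groupCohomology (charRep k c) 0 ≃ₗ[k]
      groupCohomology (charRep k (C.χ * c)) 1) := by
  have htors : ∀ (c : G →* (ZMod p)ˣ) (a : charRep k c), p • a = 0 := fun c (a : ZMod p) => by
    simp
  have hsub : ∀ (c : G →* (ZMod p)ˣ) (i : ℕ),
      Subsingleton (groupCohomology (coindRes S (charRep k c)) (i + 1)) := fun c i =>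
    subsingleton_coindRes hS _ (htors c) i.succ_ne_zero
  have hc' : ∀ a, (C.χ * c) (C.elt a) = 1 := fun a => by
    rw [MonoidHom.mul_apply, C.χ_elt, hc, one_mul]
  have : Mono (unit S (charRep k (C.χ * c))) := (Rep.mono_iff_injective _).mpr (unit_injective _)
  have : Epi (C.trace (C.charRep_ρ_elt k hc)) :=
    (Rep.epi_iff_surjective _).mpr (C.trace_surjective k hc)
  have hE1 := C.exact_unit_convInv k hp hc
  have hE2 := C.exact_convInv_trace k hp hc
  obtain ⟨W, u, v, hu, hv, h1, h2⟩ := exists_shortExact_of_exact (unit S (charRep k (C.χ * c)))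
    (C.convInv k c) (C.trace (C.charRep_ρ_elt k hc))
    (Rep.hom_ext (Representation.IntertwiningMap.ext (LinearMap.ext hE1.apply_apply_eq_zero)))
    (Rep.hom_ext (Representation.IntertwiningMap.ext (LinearMap.ext hE2.apply_apply_eq_zero)))
    (Rep.exact_of_function_exact _ hE1) (Rep.exact_of_function_exact _ hE2)
  have hu0 := C.map_zero_unit_surjective (C.charRep_ρ_elt k hc)
  have hu0' := C.map_zero_unit_surjective (C.charRep_ρ_elt k hc')
  have : Mono (unit S (charRep k c)) := (Rep.mono_iff_injective _).mpr (unit_injective _)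
  have := h2.mono_f
  have ht : (functor k G 0).map (C.trace (C.charRep_ρ_elt k hc)) = 0 :=
    C.map_zero_trace _ (htors c)
  have hsubW := hsub c 0
  have hsubV := hsub (C.χ * c)
  have e1 : ∀ i, Nonempty (groupCohomology (charRep k c) i ≃ₗ[k] groupCohomology W (i + 1)) :=
    fun i => match i with
    | 0 => nonempty_equiv_succ_of_map_eq_zero h2 ht
    | i + 1 =>
      have := hsub c i
      have := hsub c (i + 1)
      nonempty_equiv_succ h2
  obtain ⟨e2⟩ : Nonempty (groupCohomology W (i + 1) ≃ₗ[k]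
      groupCohomology (charRep k (C.χ * c)) (i + 2)) := by
    have := hsubV i
    have := hsubV (i + 1)
    exact nonempty_equiv_succ h1
  obtain ⟨e3⟩ : Nonempty (groupCohomology W 0 ≃ₗ[k]
      groupCohomology (charRep k (C.χ * c)) 1) := by
    have := hsubV 0
    exact nonempty_equiv_succ_of_map_eq_zero h1 (map_eq_zero_of_surjective h1 hu0')
  obtain ⟨e4⟩ : Nonempty (groupCohomology W 0 ≃ₗ[k]
      groupCohomology (coindRes S (charRep k c)) 0) :=
    nonempty_equiv_zero v (surjective_of_map_eq_zero h2 ht)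
  obtain ⟨e5⟩ := nonempty_equiv_zero _ hu0
  obtain ⟨e1⟩ := e1 i
  exact ⟨⟨e1.trans e2⟩, ⟨(e5.trans e4.symm).trans e3⟩⟩

/-- The cohomology of `G` with coefficients in `ZMod p` vanishes in all degrees `j` but those
such that `2 * orderOf C.χ` divides `j` or `j + 1`, where it has order `p`. -/
lemma card_groupCohomology_charRep_one [Finite G] [IsCyclic S] (hS : (Nat.card S).Coprime p)
    (hp : p ≠ 2) (j : ℕ) :
    Nat.card (groupCohomology (charRep k (1 : G →* (ZMod p)ˣ)) j) =
      if 2 * orderOf C.χ ∣ j ∨ 2 * orderOf C.χ ∣ j + 1 then p else 1 := by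
  have htriv : ∀ n : ℤ, ∀ a, (C.χ ^ n) (C.elt a) = 1 := fun n a => by
    rw [MonoidHom.zpow_apply, C.χ_elt, one_zpow]
  have hχ0 : C.χ ^ (0 : ℤ) = 1 := zpow_zero C.χ
  have hχ : ∀ n : ℤ, C.χ * C.χ ^ (n - 1) = C.χ ^ n := fun n =>
    (zpow_one_add C.χ _).symm.trans (by rw [add_sub_cancel])
  have h0 : ∀ n : ℤ, Nat.card (groupCohomology (charRep k (C.χ ^ n)) 0) =
      if (orderOf C.χ : ℤ) ∣ n then p else 1 := fun n => by
    rw [Nat.card_congr (H0Iso (charRep k (C.χ ^ n))).toLinearEquiv.toEquiv]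
    have hmem : ∀ v : ZMod p, v ∈ (charRep k (C.χ ^ n)).ρ.invariants ↔
        ∀ g, ((C.χ ^ n) g * v : ZMod p) = v := fun v => Iff.rfl
    have hdvd : (orderOf C.χ : ℤ) ∣ n ↔ C.χ ^ n = 1 := orderOf_dvd_iff_zpow_eq_one
    split_ifs with h
    · rw [hdvd] at h
      have htop : (charRep k (C.χ ^ n)).ρ.invariants = ⊤ :=
        eq_top_iff.mpr fun v _ => (hmem v).mpr fun g => by rw [h]; exact one_mul v
      change Nat.card (charRep k (C.χ ^ n)).ρ.invariants = p
      rw [htop]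
      exact (Nat.card_congr (Submodule.topEquiv (R := k) (M := ZMod p)).toEquiv).trans
        (Nat.card_zmod p)
    · have hbot : (charRep k (C.χ ^ n)).ρ.invariants = ⊥ :=
        eq_bot_iff.mpr fun v hv => by
          by_contra h0
          refine h (hdvd.mpr (MonoidHom.ext fun g => Units.ext ?_))
          exact mul_right_cancel₀ h0 (((hmem v).mp hv g).trans (one_mul (v : ZMod p)).symm)
      change Nat.card (charRep k (C.χ ^ n)).ρ.invariants = 1
      rw [hbot]
      simp
  have heven : ∀ (i : ℕ) (n : ℤ), Nat.card (groupCohomology (charRep k (C.χ ^ n)) (2 * i)) =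
      if (orderOf C.χ : ℤ) ∣ n - i then p else 1 := fun i => by
    induction i with
    | zero => simpa using h0
    | succ i ih =>
      intro n
      obtain ⟨e⟩ := (C.nonempty_equiv_add_two (k := k) hS hp (htriv (n - 1)) (2 * i)).1
      rw [hχ] at e
      rw [mul_add, mul_one, ← Nat.card_congr e.toEquiv, ih]
      push_cast
      rw [sub_sub, add_comm (1 : ℤ)]
  have hodd : ∀ (i : ℕ) (n : ℤ), Nat.card (groupCohomology (charRep k (C.χ ^ n)) (2 * i + 1)) =
      if (orderOf C.χ : ℤ) ∣ n - (i + 1) then p else 1 := fun i => by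
    induction i with
    | zero =>
      intro n
      obtain ⟨e⟩ := (C.nonempty_equiv_add_two (k := k) hS hp (htriv (n - 1)) 0).2
      rw [hχ] at e
      rw [mul_zero, zero_add, ← Nat.card_congr e.toEquiv, h0]
      simp
    | succ i ih =>
      intro n
      obtain ⟨e⟩ := (C.nonempty_equiv_add_two (k := k) hS hp (htriv (n - 1)) (2 * i + 1)).1
      rw [hχ] at e
      rw [mul_add, mul_one, add_right_comm, ← Nat.card_congr e.toEquiv, ih]
      push_cast
      rw [sub_sub, add_comm (1 : ℤ)]
  obtain ⟨i, rfl | rfl⟩ := j.even_or_odd'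
  · have := heven i 0
    rw [hχ0] at this
    rw [this]
    have h1 : ¬ 2 * orderOf C.χ ∣ 2 * i + 1 := fun h => by
      have := (Dvd.intro _ rfl).trans h; omega
    simp [h1, Int.natCast_dvd_natCast, Nat.mul_dvd_mul_iff_left]
  · have := hodd i 0
    rw [hχ0] at this
    rw [this]
    have h1 : ¬ 2 * orderOf C.χ ∣ 2 * i + 1 := fun h => by
      have := (Dvd.intro _ rfl).trans h; omega
    have h2 : 2 * i + 1 + 1 = 2 * (i + 1) := by ring
    have h3 : (0 : ℤ) - (i + 1) = -((i + 1 : ℕ) : ℤ) := by push_cast; ring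
    rw [h2, h3]
    simp only [h1, false_or, Nat.mul_dvd_mul_iff_left two_pos, Int.dvd_neg,
      Int.natCast_dvd_natCast]

end CyclicNormalComplement

namespace groupCohomology

variable (k : Type) [CommRing k] {G H K : Type} [Group G] [Group H] [Group K]

/-- The restriction of a trivial representation, as a map to the trivial representation. -/
noncomputable def resTrivial (f : G →* H) :
    Rep.res f (Rep.trivial k H k) ⟶ Rep.trivial k G k :=
  Rep.ofHom ⟨LinearMap.id, fun _ => rfl⟩

/-- The pullback on cohomology with trivial coefficients along a group homomorphism. -/
noncomputable def trivialMap (f : G →* H) (i : ℕ) :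
    groupCohomology (Rep.trivial k H k) i →ₗ[k] groupCohomology (Rep.trivial k G k) i :=
  (map f (resTrivial k f) i).hom

lemma trivialMap_comp (f : H →* K) (g : G →* H) (i : ℕ) :
    trivialMap k (f.comp g) i = trivialMap k g i ∘ₗ trivialMap k f i := by
  rw [trivialMap, trivialMap, trivialMap, ← ModuleCat.hom_comp, ← map_comp]
  rfl

lemma trivialMap_id (i : ℕ) : trivialMap k (MonoidHom.id G) i = LinearMap.id :=
  congrArg ModuleCat.Hom.hom (map_id (B := Rep.trivial k G k) (n := i))

end groupCohomology

namespace CyclicNormalComplement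

open groupCohomology

variable {G : Type} [Group G] {S : Subgroup G} {p : ℕ} (C : CyclicNormalComplement S p)

/-- The cohomology of a group with integer coefficients. -/
noncomputable abbrev intCohomology (G : Type) [Group G] (i : ℕ) : Type :=
  groupCohomology (Rep.trivial ℤ G ℤ) i

/-- Restriction to `S` on integral cohomology. -/
noncomputable def restr (S : Subgroup G) (i : ℕ) : intCohomology G i →+ intCohomology S i :=
  (trivialMap ℤ S.subtype i).toAddMonoidHom

/-- Inflation along a retraction onto `S` on integral cohomology. -/
noncomputable def infl (π : G →* S) (i : ℕ) : intCohomology S i →+ intCohomology G i :=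
  (trivialMap ℤ π i).toAddMonoidHom

lemma restr_infl {π : G →* S} (hπ : ∀ s : S, π s = s) (i : ℕ) (x : intCohomology S i) :
    restr S i (infl π i x) = x := by
  change (trivialMap ℤ S.subtype i ∘ₗ trivialMap ℤ π i) x = x
  rw [← trivialMap_comp, show π.comp S.subtype = MonoidHom.id S from MonoidHom.ext hπ,
    trivialMap_id]
  rfl

/-- A retraction onto `S` splits the integral cohomology of `S` off that of `G`. -/
noncomputable def splitEquiv {π : G →* S} (hπ : ∀ s : S, π s = s) (i : ℕ) :
    intCohomology G i ≃+ intCohomology S i × (restr S i).ker where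
  toFun x := (restr S i x, ⟨x - infl π i (restr S i x), by
    rw [AddMonoidHom.mem_ker, map_sub, restr_infl hπ, sub_self]⟩)
  invFun x := infl π i x.1 + x.2
  left_inv x := add_sub_cancel _ _
  right_inv x := by
    have h := x.2.2
    rw [AddMonoidHom.mem_ker] at h
    refine Prod.ext ?_ (Subtype.ext ?_)
    · simp [restr_infl hπ, h]
    · simp [restr_infl hπ, h]
  map_add' x y := by
    refine Prod.ext (map_add _ _ _) (Subtype.ext ?_)
    simp only [map_add]
    exact add_sub_add_comm _ _ _ _

lemma finite_intCohomology (H : Type) [Group H] [Finite H] [IsCyclic H] {i : ℕ} (hi : i ≠ 0) :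
    Finite (intCohomology H i) := by
  rcases i.even_or_odd with he | ho
  · obtain ⟨e⟩ := nonempty_trivial_int_addEquiv (H := H) hi he
    have : NeZero (Nat.card H) := ⟨Nat.card_pos.ne'⟩
    exact Finite.of_equiv _ e.toEquiv
  · have := subsingleton_trivial_int_of_odd (H := H) ho
    infer_instance

variable [Finite S] [IsCyclic S] (hS : (Nat.card S).Coprime p)

include hS

lemma restr_eq_zero {i : ℕ} (hi : i ≠ 0) {x : intCohomology G i} (hx : p • x = 0) :
    restr S i x = 0 :=
  eq_zero_of_coprime_nsmul hS (card_nsmul_eq_zero _ hi _) (by rw [← map_nsmul, hx, map_zero])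

variable [Fact p.Prime]

include C in
/-- The kernel of restriction to a cyclic complement of order prime to `p` is `p`-torsion. -/
lemma nsmul_eq_zero_of_restr {π : G →* S} (hπ : ∀ s : S, π s = s) {i : ℕ} (hi : i ≠ 0)
    {x : intCohomology G i} (hx : restr S i x = 0) : p • x = 0 := by
  let A := Rep.trivial ℤ G ℤ
  let u : intCohomology G i →+ groupCohomology (coindRes S A) i :=
    ((functor ℤ G i).map (unit S A)).hom.toAddMonoidHom
  have hu : ∀ y, u y = 0 → p • y = 0 := fun y hy => by
    have hA : ∀ a, A.ρ (C.elt a) = 1 := fun _ => rfl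
    have h1 : ((functor ℤ G i).map (unit S A ≫ C.trace hA)).hom y = 0 := by
      rw [Functor.map_comp]
      exact (congrArg ((functor ℤ G i).map (C.trace hA)).hom hy).trans (map_zero _)
    rw [C.unit_comp_trace] at h1
    exact (natCast_zsmul y p).symm.trans ((map_zsmul_id A i p y).symm.trans h1)
  have hcard : Nat.card (intCohomology S i) = Nat.card (groupCohomology (coindRes S A) i) :=
    Nat.card_congr (coindResIso (S := S) A i).symm.toEquiv
  have : Finite (intCohomology S i) := finite_intCohomology S hi
  have hinfl : ∀ y, p • infl π i y = 0 → y = 0 := fun y hy => by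
    rw [← restr_infl hπ i y]
    exact restr_eq_zero hS hi hy
  have hinj : Function.Injective (u.comp (infl π i)) :=
    (injective_iff_map_eq_zero _).mpr fun y hy => hinfl y (hu _ hy)
  have hsurj : Function.Surjective (u.comp (infl π i)) := by
    have := Finite.of_equiv (intCohomology S i) (coindResIso (S := S) A i).symm.toEquiv
    exact ((Nat.bijective_iff_injective_and_card _).mpr ⟨hinj, hcard⟩).2
  obtain ⟨y, hy⟩ := hsurj (u x)
  have h1 : p • (infl π i y - x) = 0 := hu _ (by rw [map_sub, ← hy]; exact sub_self _)
  have h2 : y = 0 := by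
    have := restr_eq_zero hS hi h1
    rwa [map_sub, restr_infl hπ, hx, sub_zero] at this
  refine hu x ?_
  rw [← hy, h2, map_zero]

end CyclicNormalComplement

namespace CyclicNormalComplement

open groupCohomology

section Bockstein

variable (G : Type) [Group G] (p : ℕ) [Fact p.Prime]

/-- Reduction modulo `p` as a map of trivial representations. -/
noncomputable def reduction : Rep.trivial ℤ G ℤ ⟶ charRep ℤ (1 : G →* (ZMod p)ˣ) :=
  Rep.ofHom ⟨Algebra.linearMap ℤ (ZMod p), fun _ =>
    LinearMap.ext fun m => (one_mul (m : ZMod p)).symm⟩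

lemma exact_nsmul_reduction :
    Function.Exact ((p : ℤ) • 𝟙 (Rep.trivial ℤ G ℤ)).hom (reduction G p).hom := fun m => by
  refine (ZMod.intCast_zmod_eq_zero_iff_dvd m p).trans ⟨fun ⟨l, hl⟩ => ⟨l, hl.symm⟩, ?_⟩
  rintro ⟨l, hl⟩
  exact ⟨l, hl.symm⟩

/-- The Bockstein short complex `ℤ ⟶ ℤ ⟶ ZMod p`. -/
noncomputable abbrev bocksteinComplex : ShortComplex (Rep.{0} ℤ G) :=
  ShortComplex.mk ((p : ℤ) • 𝟙 (Rep.trivial ℤ G ℤ)) (reduction G p)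
    (Rep.hom_ext (Representation.IntertwiningMap.ext (LinearMap.ext
      (exact_nsmul_reduction G p).apply_apply_eq_zero)))

lemma bocksteinComplex_shortExact : (bocksteinComplex G p).ShortExact where
  exact := Rep.exact_of_function_exact _ (exact_nsmul_reduction G p)
  mono_f := (Rep.mono_iff_injective _).mpr fun _ _ h =>
    mul_left_cancel₀ (Int.natCast_ne_zero.mpr (Fact.out : p.Prime).ne_zero) h
  epi_g := (Rep.epi_iff_surjective _).mpr ZMod.intCast_surjective

/-- The cohomology of a group with coefficients in `ZMod p`. -/
noncomputable abbrev modCohomology (i : ℕ) : Type :=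
  groupCohomology (charRep ℤ (1 : G →* (ZMod p)ˣ)) i

/-- Reduction modulo `p` on cohomology. -/
noncomputable def mapReduction (i : ℕ) : intCohomology G i →+ modCohomology G p i :=
  ((functor ℤ G i).map (reduction G p)).hom.toAddMonoidHom

/-- The Bockstein homomorphism. -/
noncomputable def bockstein (i : ℕ) : modCohomology G p i →+ intCohomology G (i + 1) :=
  (δ (bocksteinComplex_shortExact G p) i (i + 1) rfl).hom.toAddMonoidHom

lemma map_bocksteinComplex_f (i : ℕ) (y : intCohomology G i) :
    ((functor ℤ G i).map (bocksteinComplex G p).f).hom y = p • y :=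
  (map_zsmul_id (Rep.trivial ℤ G ℤ) i p y).trans (natCast_zsmul y p)

lemma mapReduction_eq_zero_iff {i : ℕ} {x : intCohomology G i} :
    mapReduction G p i x = 0 ↔ ∃ y : intCohomology G i, p • y = x :=
  (exact_map_map (bocksteinComplex_shortExact G p) x).trans <| exists_congr fun y =>
    ⟨(map_bocksteinComplex_f G p i y).symm.trans, (map_bocksteinComplex_f G p i y).trans⟩

lemma bockstein_eq_zero_iff {i : ℕ} {x : modCohomology G p i} :
    bockstein G p i x = 0 ↔ ∃ y : intCohomology G i, mapReduction G p i y = x :=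
  exact_map_δ (bocksteinComplex_shortExact G p) x

lemma nsmul_eq_zero_iff {i : ℕ} {x : intCohomology G (i + 1)} :
    p • x = 0 ↔ ∃ y : modCohomology G p i, bockstein G p i y = x := by
  refine Iff.trans ?_ (exact_δ_map (bocksteinComplex_shortExact G p) x)
  exact ⟨(map_bocksteinComplex_f G p (i + 1) x).trans,
    (map_bocksteinComplex_f G p (i + 1) x).symm.trans⟩

variable {G p}

lemma eq_zero_of_card_eq_one {i : ℕ} (h : Nat.card (modCohomology G p i) = 1)
    {x : intCohomology G (i + 1)} (hx : p • x = 0) : x = 0 := by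
  obtain ⟨y, rfl⟩ := (nsmul_eq_zero_iff G p).mp hx
  have := (Nat.card_eq_one_iff_unique.mp h).1
  rw [Subsingleton.elim y 0, map_zero]

lemma eq_zero_of_card_eq_prime {i : ℕ} (h : Nat.card (modCohomology G p i) = p)
    {z : intCohomology G i} (hz : ∀ y, p • y ≠ z)
    {x : intCohomology G (i + 1)} (hx : p • x = 0) : x = 0 := by
  obtain ⟨y, rfl⟩ := (nsmul_eq_zero_iff G p).mp hx
  have : Fact (Nat.card (modCohomology G p i)).Prime := h.symm ▸ inferInstance
  have htop : (mapReduction G p i).range = ⊤ :=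
    (AddSubgroup.eq_bot_or_eq_top_of_prime_card _).resolve_left fun hbot => by
      have hz0 : mapReduction G p i z = 0 := by
        rw [← AddSubgroup.mem_bot, ← hbot]
        exact ⟨z, rfl⟩
      obtain ⟨y, hy⟩ := (mapReduction_eq_zero_iff G p).mp hz0
      exact hz y hy
  exact (bockstein_eq_zero_iff G p).mpr (AddMonoidHom.range_eq_top.mp htop y)

lemma nonempty_equiv_of_subsingleton {i : ℕ} (h : Nat.card (modCohomology G p i) = p)
    [Subsingleton (intCohomology G i)] (K : AddSubgroup (intCohomology G (i + 1)))
    (hK : ∀ x, x ∈ K ↔ p • x = 0) : Nonempty (K ≃+ ZMod p) := by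
  have hinj : Function.Injective (bockstein G p i) :=
    (injective_iff_map_eq_zero _).mpr fun x hx => by
      obtain ⟨y, rfl⟩ := (bockstein_eq_zero_iff G p).mp hx
      rw [Subsingleton.elim y 0, map_zero]
  have hrange : (bockstein G p i).range = K :=
    AddSubgroup.ext fun x => ((hK x).trans (nsmul_eq_zero_iff G p)).symm
  have e := (AddMonoidHom.ofInjective hinj).trans (AddEquiv.addSubgroupCongr hrange)
  have hcard : Nat.card K = p := (Nat.card_congr e.symm.toEquiv).trans h
  have : IsAddCyclic K := isAddCyclic_of_prime_card hcard
  exact ⟨(zmodAddCyclicAddEquiv this).symm.trans (ZMod.ringEquivCongr hcard).toAddEquiv⟩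

end Bockstein

variable {G : Type} [Group G] {S : Subgroup G} {p : ℕ} (C : CyclicNormalComplement S p)
  [Fact p.Prime] [Finite S] [IsCyclic S] (hS : (Nat.card S).Coprime p)
  {π : G →* S} (hπ : ∀ s : S, π s = s)

include C hS hπ

lemma mem_ker_restr_iff {i : ℕ} (hi : i ≠ 0) (x : intCohomology G i) :
    x ∈ (restr S i).ker ↔ p • x = 0 :=
  ⟨C.nsmul_eq_zero_of_restr hS hπ hi, restr_eq_zero hS hi⟩

lemma subsingleton_ker_restr_of_card_eq_one {i : ℕ} (h : Nat.card (modCohomology G p i) = 1) :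
    Subsingleton (restr S (i + 1)).ker :=
  subsingleton_of_forall_eq 0 fun x => Subtype.ext (eq_zero_of_card_eq_one h
    ((C.mem_ker_restr_iff hS hπ i.succ_ne_zero _).mp x.2))

omit C hS [Fact p.Prime] in
lemma subsingleton_of_odd_of_ker {i : ℕ} (hi : Odd i) [Subsingleton (restr S i).ker] :
    Subsingleton (intCohomology G i) :=
  have := subsingleton_trivial_int_of_odd (H := S) hi
  (splitEquiv hπ i).toEquiv.subsingleton

variable [Finite G] (hp : p ≠ 2) (hχ : 2 ≤ orderOf C.χ)

include hp hχ

lemma nonempty_ker_restr_equiv {i : ℕ} (hi : i ≠ 0) (hdvd : 2 * orderOf C.χ ∣ i) :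
    Nonempty ((restr S i).ker ≃+ ZMod p) := by
  have h2 : 2 ∣ i := (Dvd.intro _ rfl).trans hdvd
  obtain ⟨j, rfl⟩ : ∃ j, i = j + 1 + 1 := ⟨i - 2, by omega⟩
  have hj : Nat.card (modCohomology G p j) = 1 := by
    rw [C.card_groupCohomology_charRep_one hS hp, if_neg]
    rintro (h | h)
    · have := Nat.le_of_dvd two_pos ((Nat.dvd_add_right h).mp hdvd)
      omega
    · have := (Dvd.intro _ rfl).trans h
      omega
  have hj1 : Nat.card (modCohomology G p (j + 1)) = p := by
    rw [C.card_groupCohomology_charRep_one hS hp, if_pos (Or.inr hdvd)]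
  have := C.subsingleton_ker_restr_of_card_eq_one hS hπ hj
  have := subsingleton_of_odd_of_ker hπ (i := j + 1) (by
    rw [Nat.odd_iff]; omega)
  exact nonempty_equiv_of_subsingleton hj1 _ (C.mem_ker_restr_iff hS hπ hi)

lemma exists_forall_nsmul_ne {i : ℕ} (hdvd : 2 * orderOf C.χ ∣ i) :
    ∃ z : intCohomology G i, ∀ y, p • y ≠ z := by
  rcases eq_or_ne i 0 with rfl | hi
  · let e := (H0IsoOfIsTrivial (Rep.trivial ℤ G ℤ)).toLinearEquiv
    refine ⟨e.symm (1 : ℤ), fun y hy => ?_⟩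
    have h1 : p • (e y : ℤ) = 1 := by
      rw [LinearEquiv.eq_symm_apply, map_nsmul] at hy
      exact hy
    rw [nsmul_eq_mul] at h1
    have := Int.eq_one_of_dvd_one (Int.natCast_nonneg p) ⟨_, h1.symm⟩
    exact (Fact.out : p.Prime).ne_one (by exact_mod_cast this)
  · obtain ⟨e⟩ := C.nonempty_ker_restr_equiv hS hπ hp hχ hi hdvd
    refine ⟨e.symm 1, fun y hy => ?_⟩
    have hpy : restr S i y = 0 := by
      refine eq_zero_of_coprime_nsmul hS (card_nsmul_eq_zero _ hi _) ?_
      rw [← map_nsmul, hy]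
      exact (e.symm 1).2
    rw [C.nsmul_eq_zero_of_restr hS hπ hi hpy] at hy
    have h1 : e.symm 1 = 0 := Subtype.ext hy.symm
    exact one_ne_zero ((AddEquiv.map_eq_zero_iff _).mp h1)

lemma subsingleton_ker_restr {i : ℕ} (hi : i ≠ 0) (hdvd : ¬ 2 * orderOf C.χ ∣ i) :
    Subsingleton (restr S i).ker := by
  obtain ⟨j, rfl⟩ := Nat.exists_eq_succ_of_ne_zero hi
  have hcard := C.card_groupCohomology_charRep_one (k := ℤ) hS hp j
  by_cases hj : 2 * orderOf C.χ ∣ j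
  · rw [if_pos (Or.inl hj)] at hcard
    obtain ⟨z, hz⟩ := C.exists_forall_nsmul_ne hS hπ hp hχ hj
    exact subsingleton_of_forall_eq 0 fun x => Subtype.ext (eq_zero_of_card_eq_prime hcard hz
      ((C.mem_ker_restr_iff hS hπ hi _).mp x.2))
  · rw [if_neg (not_or.mpr ⟨hj, hdvd⟩)] at hcard
    exact C.subsingleton_ker_restr_of_card_eq_one hS hπ hcard

lemma subsingleton_of_odd {i : ℕ} (hi : Odd i) : Subsingleton (intCohomology G i) :=
  have := C.subsingleton_ker_restr hS hπ hp hχ hi.pos.ne' fun h =>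
    Nat.not_even_iff_odd.mpr hi (even_iff_two_dvd.mpr ((Dvd.intro _ rfl).trans h))
  subsingleton_of_odd_of_ker hπ hi

lemma nonempty_equiv_of_not_dvd {i : ℕ} (hi : i ≠ 0) (he : Even i)
    (hdvd : ¬ 2 * orderOf C.χ ∣ i) : Nonempty (intCohomology G i ≃+ ZMod (Nat.card S)) := by
  have := C.subsingleton_ker_restr hS hπ hp hχ hi hdvd
  have := uniqueOfSubsingleton (0 : (restr S i).ker)
  obtain ⟨e⟩ := nonempty_trivial_int_addEquiv (H := S) hi he
  exact ⟨(splitEquiv hπ i).trans (AddEquiv.prodUnique.trans e.symm)⟩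

lemma nonempty_equiv_of_dvd {i : ℕ} (hi : i ≠ 0) (hdvd : 2 * orderOf C.χ ∣ i) :
    Nonempty (intCohomology G i ≃+ ZMod p × ZMod (Nat.card S)) := by
  obtain ⟨e⟩ := C.nonempty_ker_restr_equiv hS hπ hp hχ hi hdvd
  obtain ⟨e'⟩ := nonempty_trivial_int_addEquiv (H := S) hi
    (even_iff_two_dvd.mpr ((Dvd.intro _ rfl).trans hdvd))
  exact ⟨(splitEquiv hπ i).trans ((e'.symm.prodCongr e).trans AddEquiv.prodComm)⟩

end CyclicNormalComplement

/-- An automorphism of `ℤ/p` is multiplication by a unit. -/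
def mulAutEquivUnits (p : ℕ) : MulAut (Multiplicative (ZMod p)) ≃* (ZMod p)ˣ :=
  (MulAutMultiplicative (ZMod p)).trans (AddEquiv.toMultiplicativeLeft (ZMod.AddAutEquivUnits p))

lemma ofAdd_mulAutEquivUnits_mul {p : ℕ} (f : MulAut (Multiplicative (ZMod p))) (a : ZMod p) :
    Multiplicative.ofAdd ((mulAutEquivUnits p f : ZMod p) * a) = f (Multiplicative.ofAdd a) := by
  obtain ⟨u, rfl⟩ := (mulAutEquivUnits p).symm.surjective f
  rw [MulEquiv.apply_symm_apply]
  rfl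

namespace SemidirectProduct

variable {p : ℕ} {H : Type} [Group H] (φ : H →* MulAut (Multiplicative (ZMod p)))

/-- In `ℤ/p ⋊ H`, the factor `H` is a complement of the normal subgroup `ℤ/p`. -/
def cyclicNormalComplement :
    CyclicNormalComplement (inr : H →* Multiplicative (ZMod p) ⋊[φ] H).range p where
  elt a := inl (Multiplicative.ofAdd a)
  χ := (mulAutEquivUnits p).toMonoidHom.comp (φ.comp rightHom)
  elt_add a b := by rw [ofAdd_add, map_mul]
  mul_elt g a := by
    change _ = inl (Multiplicative.ofAdd ((mulAutEquivUnits p (φ g.right) : ZMod p) * a)) * g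
    rw [ofAdd_mulAutEquivUnits_mul]
    ext
    · simp [mul_comm]
    · simp
  exists_mul_elt g := by
    refine ⟨inr g.right, ⟨_, rfl⟩, Multiplicative.toAdd (φ g.right⁻¹ g.left), ?_⟩
    ext <;> simp
  eq_zero_of_mem := by
    rintro a ⟨h, hh⟩
    exact (congrArg left hh).symm

lemma card_range_inr : Nat.card (inr : H →* Multiplicative (ZMod p) ⋊[φ] H).range = Nat.card H :=
  (Nat.card_congr (MonoidHom.ofInjective inr_injective).toEquiv).symm

lemma rangeRestrict_rightHom (s : (inr : H →* Multiplicative (ZMod p) ⋊[φ] H).range) :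
    (inr : H →* Multiplicative (ZMod p) ⋊[φ] H).rangeRestrict.comp rightHom
      (s : Multiplicative (ZMod p) ⋊[φ] H) = s := by
  obtain ⟨_, h, rfl⟩ := s
  rfl

lemma orderOf_χ_cyclicNormalComplement {h : H} (hh : ∀ x, x ∈ Subgroup.zpowers h) :
    orderOf (cyclicNormalComplement φ).χ = orderOf (φ h) := by
  refine orderOf_eq_orderOf_iff.mpr fun k => ?_
  have key : ∀ x : Multiplicative (ZMod p) ⋊[φ] H,
      ((cyclicNormalComplement φ).χ ^ k) x = mulAutEquivUnits p (φ x.right ^ k) := fun x => by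
    rw [map_pow]; rfl
  constructor
  · intro h1
    have := key (inr h)
    rw [h1, MonoidHom.one_apply, right_inr] at this
    exact (map_eq_one_iff _ (mulAutEquivUnits p).injective).mp this.symm
  · intro h1
    ext x : 1
    obtain ⟨m, hm⟩ := hh x.right
    rw [key, ← show h ^ m = x.right from hm, map_zpow, ← zpow_natCast, zpow_comm, zpow_natCast, h1,
      one_zpow, map_one, MonoidHom.one_apply]

end SemidirectProduct

end CyclicNormalComplementCohomology

section

variable (p q n : ℕ) (φ : Multiplicative (ZMod (q ^ n)) →* MulAut (Multiplicative (ZMod p)))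

local notation "D" => Multiplicative (ZMod p) ⋊[φ] Multiplicative (ZMod (q ^ n))

/-- The integral cohomology of the minimal non-abelian group `D = ℤ/p ⋊ ℤ/qⁿ`, where the
generator of `ℤ/qⁿ` acts by an automorphism of order exactly `q`. -/
theorem cohomology_of_semidirect_product_pqn
    (hp : p.Prime) (hq : q.Prime) (hn : 1 ≤ n)
    (hφ : orderOf (φ (Multiplicative.ofAdd (1 : ZMod (q ^ n)))) = q) :
    Nonempty ((groupCohomology (Rep.trivial ℤ D ℤ) 0) ≃ₗ[ℤ] ℤ) ∧
    (∀ i : ℕ, Odd i → Subsingleton (groupCohomology (Rep.trivial ℤ D ℤ) i)) ∧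
    (∀ i : ℕ, 0 < i → Even i → ¬ (2 * q ∣ i) →
      Nonempty ((groupCohomology (Rep.trivial ℤ D ℤ) i) ≃ₗ[ℤ] ZMod (q ^ n))) ∧
    (∀ i : ℕ, 0 < i → 2 * q ∣ i →
      Nonempty ((groupCohomology (Rep.trivial ℤ D ℤ) i) ≃ₗ[ℤ] (ZMod p × ZMod (q ^ n)))) := by
  have : Fact p.Prime := ⟨hp⟩
  have : NeZero (q ^ n) := ⟨pow_ne_zero n hq.ne_zero⟩
  let C := SemidirectProduct.cyclicNormalComplement φ
  have : Finite D := Finite.of_equiv _ SemidirectProduct.equivProd.symm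
  have hgen : ∀ x : Multiplicative (ZMod (q ^ n)),
      x ∈ Subgroup.zpowers (Multiplicative.ofAdd (1 : ZMod (q ^ n))) := fun x =>
    ⟨(x.toAdd.val : ℤ), by
      change Multiplicative.ofAdd (1 : ZMod (q ^ n)) ^ (x.toAdd.val : ℤ) = x
      rw [zpow_natCast, ← ofAdd_nsmul, nsmul_one, ZMod.natCast_zmod_val, ofAdd_toAdd]⟩
  have hord : orderOf C.χ = q :=
    (SemidirectProduct.orderOf_χ_cyclicNormalComplement φ hgen).trans hφ
  have hcard := (SemidirectProduct.card_range_inr φ).trans (Nat.card_zmod (q ^ n))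
  have hπ := SemidirectProduct.rangeRestrict_rightHom φ
  have hqp : q ∣ p - 1 := by
    rw [← hφ, ← MulEquiv.orderOf_eq (mulAutEquivUnits p), ← ZMod.card_units p]
    exact orderOf_dvd_card
  have hlt : q < p := by
    have := Nat.le_of_dvd (Nat.sub_pos_of_lt hp.one_lt) hqp
    have := hp.pos
    omega
  have hp2 : p ≠ 2 := (hq.two_le.trans_lt hlt).ne'
  have hS : (Nat.card (SemidirectProduct.inr : _ →* D).range).Coprime p := by
    rw [hcard]
    exact ((Nat.coprime_primes hq hp).mpr hlt.ne).pow_left n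
  have hχ : 2 ≤ orderOf C.χ := hq.two_le.trans_eq hord.symm
  have : IsCyclic (SemidirectProduct.inr : _ →* D).range :=
    isCyclic_of_surjective _ (SemidirectProduct.inr : _ →* D).rangeRestrict_surjective
  refine ⟨⟨(groupCohomology.H0IsoOfIsTrivial (Rep.trivial ℤ D ℤ)).toLinearEquiv⟩,
    fun i hi => C.subsingleton_of_odd hS hπ hp2 hχ hi, fun i hi he hdvd => ?_,
    fun i hi hdvd => ?_⟩
  · obtain ⟨e⟩ := C.nonempty_equiv_of_not_dvd hS hπ hp2 hχ hi.ne' he (hord.symm ▸ hdvd)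
    rw [hcard] at e
    exact ⟨e.toLinearEquiv fun c x => map_intCast_smul e ℤ ℤ c x⟩
  · obtain ⟨e⟩ := C.nonempty_equiv_of_dvd hS hπ hp2 hχ hi.ne' (hord.symm ▸ hdvd)
    rw [hcard] at e
    exact ⟨e.toLinearEquiv fun c x => map_intCast_smul e ℤ ℤ c x⟩

end
end

section
/- Let Q₈ be the quaternion group of order 8. Then the integral group cohomology of Q₈ with trivial coefficients satisfies: H^0(Q₈;ℤ) ≅ ℤ; H^i(Q₈;ℤ) = 0 for all odd i; H^i(Q₈;ℤ) ≅ ℤ/2 ⊕ ℤ/2 for all i ≡ 2 (mod 4); and H^i(Q₈;ℤ) ≅ ℤ/8 for all i > 0 with i ≡ 0 (mod 4). -/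
namespace QuaternionGroup

open CategoryTheory
open scoped MonoidAlgebra

/-- The integral group ring of `Q₈`. -/
abbrev GroupRing : Type := ℤ[QuaternionGroup 2]

namespace GroupRing

/-- The element of `ℤ[Q₈]` with coefficients `x₀, …, x₃` at the powers of `a` and `y₀, …, y₃` at
the elements `xa i`. -/
noncomputable def ofCoeffs (x₀ x₁ x₂ x₃ y₀ y₁ y₂ y₃ : ℤ) : GroupRing :=
  .ofCoeff (Finsupp.equivFunOnFinite.symm fun g => match g with
    | a i => (![x₀, x₁, x₂, x₃] : Fin 4 → ℤ) i
    | xa i => (![y₀, y₁, y₂, y₃] : Fin 4 → ℤ) i)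

variable {x₀ x₁ x₂ x₃ y₀ y₁ y₂ y₃ x₀' x₁' x₂' x₃' y₀' y₁' y₂' y₃' : ℤ}

lemma ext_coeff {x y : GroupRing} (h : ∀ i : Fin 4, x.coeff (a i) = y.coeff (a i))
    (h' : ∀ i : Fin 4, x.coeff (xa i) = y.coeff (xa i)) : x = y := by
  ext (i | i)
  exacts [h i, h' i]

lemma exists_eq_ofCoeffs (x : GroupRing) : ∃ x₀ x₁ x₂ x₃ y₀ y₁ y₂ y₃ : ℤ,
    x = ofCoeffs x₀ x₁ x₂ x₃ y₀ y₁ y₂ y₃ := by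
  refine ⟨x.coeff (a 0), x.coeff (a 1), x.coeff (a 2), x.coeff (a 3),
    x.coeff (xa 0), x.coeff (xa 1), x.coeff (xa 2), x.coeff (xa 3), ext_coeff ?_ ?_⟩ <;>
  · intro i
    fin_cases i <;> rfl

lemma ofCoeffs_inj : ofCoeffs x₀ x₁ x₂ x₃ y₀ y₁ y₂ y₃ = ofCoeffs x₀' x₁' x₂' x₃' y₀' y₁' y₂' y₃' ↔
    x₀ = x₀' ∧ x₁ = x₁' ∧ x₂ = x₂' ∧ x₃ = x₃' ∧ y₀ = y₀' ∧ y₁ = y₁' ∧ y₂ = y₂' ∧ y₃ = y₃' := by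
  constructor
  · intro h
    exact ⟨congrArg (·.coeff (a 0)) h, congrArg (·.coeff (a 1)) h,
      congrArg (·.coeff (a 2)) h, congrArg (·.coeff (a 3)) h,
      congrArg (·.coeff (xa 0)) h, congrArg (·.coeff (xa 1)) h,
      congrArg (·.coeff (xa 2)) h, congrArg (·.coeff (xa 3)) h⟩
  · rintro ⟨rfl, rfl, rfl, rfl, rfl, rfl, rfl, rfl⟩
    rfl

lemma zero_eq : (0 : GroupRing) = ofCoeffs 0 0 0 0 0 0 0 0 := by
  refine ext_coeff ?_ ?_ <;> · intro i; fin_cases i <;> rfl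

lemma one_eq : (1 : GroupRing) = ofCoeffs 1 0 0 0 0 0 0 0 := by
  refine ext_coeff ?_ ?_ <;>
  · intro i
    rw [MonoidAlgebra.one_def, MonoidAlgebra.coeff_single, Finsupp.single_apply]
    fin_cases i <;> rfl

lemma add_eq : ofCoeffs x₀ x₁ x₂ x₃ y₀ y₁ y₂ y₃ + ofCoeffs x₀' x₁' x₂' x₃' y₀' y₁' y₂' y₃' =
    ofCoeffs (x₀ + x₀') (x₁ + x₁') (x₂ + x₂') (x₃ + x₃') (y₀ + y₀') (y₁ + y₁') (y₂ + y₂')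
      (y₃ + y₃') := by
  refine ext_coeff ?_ ?_ <;> · intro i; fin_cases i <;> rfl

lemma neg_eq : -ofCoeffs x₀ x₁ x₂ x₃ y₀ y₁ y₂ y₃ =
    ofCoeffs (-x₀) (-x₁) (-x₂) (-x₃) (-y₀) (-y₁) (-y₂) (-y₃) := by
  refine ext_coeff ?_ ?_ <;> · intro i; fin_cases i <;> rfl

lemma sub_eq : ofCoeffs x₀ x₁ x₂ x₃ y₀ y₁ y₂ y₃ - ofCoeffs x₀' x₁' x₂' x₃' y₀' y₁' y₂' y₃' =
    ofCoeffs (x₀ - x₀') (x₁ - x₁') (x₂ - x₂') (x₃ - x₃') (y₀ - y₀') (y₁ - y₁') (y₂ - y₂')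
      (y₃ - y₃') := by
  refine ext_coeff ?_ ?_ <;> · intro i; fin_cases i <;> rfl

lemma smul_eq (n : ℤ) : n • ofCoeffs x₀ x₁ x₂ x₃ y₀ y₁ y₂ y₃ =
    ofCoeffs (n * x₀) (n * x₁) (n * x₂) (n * x₃) (n * y₀) (n * y₁) (n * y₂) (n * y₃) := by
  refine ext_coeff ?_ ?_ <;> · intro i; fin_cases i <;> rfl

/-- The group element `a`, as an element of `ℤ[Q₈]`. -/
noncomputable def α : GroupRing := .single (a 1) 1

/-- The group element `b`, as an element of `ℤ[Q₈]`. -/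
noncomputable def β : GroupRing := .single (xa 0) 1

lemma mul_α : ofCoeffs x₀ x₁ x₂ x₃ y₀ y₁ y₂ y₃ * α = ofCoeffs x₃ x₀ x₁ x₂ y₃ y₀ y₁ y₂ := by
  refine ext_coeff ?_ ?_ <;>
  · intro i
    rw [α, MonoidAlgebra.coeff_mul_single_apply, mul_one]
    fin_cases i <;> rfl

lemma mul_β : ofCoeffs x₀ x₁ x₂ x₃ y₀ y₁ y₂ y₃ * β = ofCoeffs y₂ y₁ y₀ y₃ x₀ x₃ x₂ x₁ := by
  refine ext_coeff ?_ ?_ <;>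
  · intro i
    rw [β, MonoidAlgebra.coeff_mul_single_apply, mul_one]
    fin_cases i <;> rfl

/-- The sum of all group elements. -/
noncomputable def ν : GroupRing := (1 + α + α * α + α * α * α) * (1 + β)

/-- The augmentation `ℤ[Q₈] → ℤ`. -/
noncomputable def ε : GroupRing →ₐ[ℤ] ℤ := MonoidAlgebra.lift ℤ ℤ (QuaternionGroup 2) 1

lemma ε_α : ε α = 1 := by simp [ε, α]

lemma ε_β : ε β = 1 := by simp [ε, β]

lemma ε_ofCoeffs : ε (ofCoeffs x₀ x₁ x₂ x₃ y₀ y₁ y₂ y₃) =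
    x₀ + x₁ + x₂ + x₃ + y₀ + y₁ + y₂ + y₃ := by
  have : ofCoeffs x₀ x₁ x₂ x₃ y₀ y₁ y₂ y₃ = x₀ • 1 + x₁ • (1 * α) + x₂ • (1 * α * α) +
      x₃ • (1 * α * α * α) + y₀ • (1 * β) + y₁ • (1 * α * α * α * β) + y₂ • (1 * α * α * β) +
      y₃ • (1 * α * β) := by
    simp only [one_eq, mul_α, mul_β, smul_eq, add_eq, ofCoeffs_inj]
    omega
  rw [this]
  simp [ε_α, ε_β]

lemma exists_of_ε_eq_zero {x : GroupRing} (h : ε x = 0) :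
    ∃ u v, u * (α - 1) + v * (β - 1) = x := by
  obtain ⟨x₀, x₁, x₂, x₃, y₀, y₁, y₂, y₃, rfl⟩ := exists_eq_ofCoeffs x
  refine ⟨ofCoeffs (x₁ + x₂ + x₃) (x₂ + x₃) x₃ 0 (-x₀ - x₁ - x₂ - x₃ - y₀) (y₂ + y₃) y₃ 0,
    ofCoeffs (-x₀ - x₁ - x₂ - x₃) 0 0 0 0 0 0 0, ?_⟩
  simp only [mul_sub, mul_one, mul_α, mul_β, sub_eq, add_eq, ofCoeffs_inj, ε_ofCoeffs] at h ⊢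
  omega

lemma exists_of_mul_add_mul_eq_zero {x y : GroupRing} (h : x * (α - 1) + y * (β - 1) = 0) :
    ∃ u v, u * (1 + α) + v * (1 + α * β) = x ∧ u * -(1 + β) + v * (α - 1) = y := by
  obtain ⟨x0, x1, x2, x3, x4, x5, x6, x7, rfl⟩ := exists_eq_ofCoeffs x
  obtain ⟨y0, y1, y2, y3, y4, y5, y6, y7, rfl⟩ := exists_eq_ofCoeffs y
  refine ⟨ofCoeffs (x0 - x3 + x4 - x5 + x6 - x7) x2 0 (-x0 + x3 - x4 + x5 - x6 - y0 - y3)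
    (-x0 + x3 + x5 - x6 - y0) 0 x6 (-x3 - y3),
    ofCoeffs (x3 - x6 + x7 + y3) 0 0 (x0 + x4 - x5 + x6 + y0 + y3) 0 (x0 - x3 + x6 + y0) 0 0, ?_⟩
  simp only [mul_sub, mul_add, mul_neg, mul_one, ← mul_assoc, mul_α, mul_β, sub_eq, add_eq, neg_eq,
    zero_eq, ofCoeffs_inj] at h ⊢
  omega

lemma exists_of_mul_one_add_eq_zero {x y : GroupRing}
    (h : x * (1 + α) + y * (1 + α * β) = 0) (h' : x * -(1 + β) + y * (α - 1) = 0) :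
    ∃ u, u * (α - 1) = x ∧ u * -(α * β - 1) = y := by
  obtain ⟨x0, x1, x2, x3, x4, x5, x6, x7, rfl⟩ := exists_eq_ofCoeffs x
  obtain ⟨y0, y1, y2, y3, y4, y5, y6, y7, rfl⟩ := exists_eq_ofCoeffs y
  refine ⟨ofCoeffs (-x4 - x5 + y0) (-x1 - x4 - x5 + y0) (-x1 - x2 - x4 - x5 + y0)
    (x0 - x4 - x5 + y0) (-x4) (-x4 - x5) (-x4 - x5 - x6) 0, ?_⟩
  simp only [mul_sub, mul_add, mul_neg, mul_one, ← mul_assoc, mul_α, mul_β, sub_eq, add_eq, neg_eq,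
    zero_eq, ofCoeffs_inj] at h h' ⊢
  omega

lemma exists_of_mul_eq_zero {x : GroupRing} (h : x * (α - 1) = 0) (h' : x * -(α * β - 1) = 0) :
    ∃ u, u * ν = x := by
  obtain ⟨x0, x1, x2, x3, x4, x5, x6, x7, rfl⟩ := exists_eq_ofCoeffs x
  refine ⟨ofCoeffs x0 0 0 0 0 0 0 0, ?_⟩
  simp only [ν, mul_sub, mul_add, mul_neg, mul_one, ← mul_assoc, mul_α, mul_β, sub_eq, add_eq,
    neg_eq, zero_eq, ofCoeffs_inj] at h h' ⊢
  omega

lemma ε_eq_zero_of_mul_ν_eq_zero {x : GroupRing} (h : x * ν = 0) : ε x = 0 := by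
  obtain ⟨x0, x1, x2, x3, x4, x5, x6, x7, rfl⟩ := exists_eq_ofCoeffs x
  simp only [ν, mul_add, mul_one, ← mul_assoc, mul_α, mul_β, add_eq, zero_eq, ofCoeffs_inj,
    ε_ofCoeffs] at h ⊢
  omega

/-- The matrix of the differential `P₁ ⟶ P₀`. -/
noncomputable def M₀ : Matrix (Fin 2) (Fin 1) GroupRing := !![α - 1; β - 1]

/-- The matrix of the differential `P₂ ⟶ P₁`. -/
noncomputable def M₁ : Matrix (Fin 2) (Fin 2) GroupRing := !![1 + α, -(1 + β); 1 + α * β, α - 1]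

/-- The matrix of the differential `P₃ ⟶ P₂`. -/
noncomputable def M₂ : Matrix (Fin 1) (Fin 2) GroupRing := !![α - 1, -(α * β - 1)]

/-- The matrix of the differential `P₄ ⟶ P₃`. -/
noncomputable def M₃ : Matrix (Fin 1) (Fin 1) GroupRing := !![ν]

lemma M₁_mul_M₀ : M₁ * M₀ = 0 := by
  have h (x : GroupRing) : x * ((1 + α) * (α - 1) + -(1 + β) * (β - 1)) = 0 ∧
      x * ((1 + α * β) * (α - 1) + (α - 1) * (β - 1)) = 0 := by
    obtain ⟨x0, x1, x2, x3, x4, x5, x6, x7, rfl⟩ := exists_eq_ofCoeffs x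
    simp only [mul_sub, mul_add, mul_neg, mul_one, ← mul_assoc, mul_α, mul_β, sub_eq, add_eq,
      neg_eq, zero_eq, ofCoeffs_inj]
    omega
  refine Matrix.ext fun i j => ?_
  fin_cases i <;> fin_cases j
  · simpa [M₀, M₁] using! (h 1).1
  · simpa [M₀, M₁] using! (h 1).2

lemma M₂_mul_M₁ : M₂ * M₁ = 0 := by
  have h (x : GroupRing) : x * ((α - 1) * (1 + α) + -(α * β - 1) * (1 + α * β)) = 0 ∧
      x * ((α - 1) * -(1 + β) + -(α * β - 1) * (α - 1)) = 0 := by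
    obtain ⟨x0, x1, x2, x3, x4, x5, x6, x7, rfl⟩ := exists_eq_ofCoeffs x
    simp only [mul_sub, mul_add, mul_neg, mul_one, ← mul_assoc, mul_α, mul_β, sub_eq, add_eq,
      neg_eq, zero_eq, ofCoeffs_inj]
    omega
  refine Matrix.ext fun i j => ?_
  fin_cases i; fin_cases j
  · simpa [M₁, M₂] using! (h 1).1
  · simpa [M₁, M₂] using! (h 1).2

lemma M₃_mul_M₂ : M₃ * M₂ = 0 := by
  have h (x : GroupRing) : x * (ν * (α - 1)) = 0 ∧ x * (ν * -(α * β - 1)) = 0 := by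
    obtain ⟨x0, x1, x2, x3, x4, x5, x6, x7, rfl⟩ := exists_eq_ofCoeffs x
    simp only [ν, mul_sub, mul_add, mul_neg, mul_one, ← mul_assoc, mul_α, mul_β, sub_eq, add_eq,
      neg_eq, zero_eq, ofCoeffs_inj]
    omega
  refine Matrix.ext fun i j => ?_
  fin_cases i; fin_cases j
  · simpa [M₂, M₃] using! (h 1).1
  · simpa [M₂, M₃] using! (h 1).2

lemma M₀_mul_M₃ : M₀ * M₃ = 0 := by
  have h (x : GroupRing) : x * ((α - 1) * ν) = 0 ∧ x * ((β - 1) * ν) = 0 := by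
    obtain ⟨x0, x1, x2, x3, x4, x5, x6, x7, rfl⟩ := exists_eq_ofCoeffs x
    simp only [ν, mul_sub, mul_add, mul_one, ← mul_assoc, mul_α, mul_β, sub_eq, add_eq,
      zero_eq, ofCoeffs_inj]
    omega
  refine Matrix.ext fun i j => ?_
  fin_cases i <;> fin_cases j
  · simpa [M₀, M₃] using! (h 1).1
  · simpa [M₀, M₃] using! (h 1).2

end GroupRing

open GroupRing Rep

/-- The free `ℤ[Q₈]`-module of rank `r`. -/
noncomputable abbrev freeRep (r : ℕ) : Rep ℤ (QuaternionGroup 2) :=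
  Rep.free ℤ (QuaternionGroup 2) (Fin r)

/-- The map of free `ℤ[Q₈]`-modules given by right multiplication of row vectors by a matrix. -/
noncomputable def ofMatrix {r s : ℕ} (M : Matrix (Fin r) (Fin s) GroupRing) :
    freeRep r ⟶ freeRep s :=
  Rep.freeLift ℤ (QuaternionGroup 2) (freeRep s) fun i => Finsupp.equivFunOnFinite.symm (M i)

lemma free_apply {r : ℕ} (g : QuaternionGroup 2) (x : Fin r →₀ GroupRing) (j : Fin r) :
    (Representation.free ℤ (QuaternionGroup 2) (Fin r) g x) j =
      MonoidAlgebra.single g 1 * x j := by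
  induction x using Finsupp.induction_linear with
  | zero => simp
  | add x y hx hy => rw [map_add, Finsupp.add_apply, Finsupp.add_apply, mul_add, hx, hy]
  | single i y =>
    induction y using MonoidAlgebra.induction_linear with
    | zero => simp
    | add x y hx hy =>
      rw [Finsupp.single_add, map_add, Finsupp.add_apply, Finsupp.add_apply, mul_add, hx, hy]
    | single h n =>
      rw [Representation.free_single_single]
      by_cases hij : i = j
      · subst hij
        simp [MonoidAlgebra.single_mul_single]
      · simp [hij]

lemma ofMatrix_apply {r s : ℕ} (M : Matrix (Fin r) (Fin s) GroupRing)
    (x : Fin r →₀ GroupRing) (j : Fin s) :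
    ((ofMatrix M).hom x : Fin s →₀ GroupRing) j = ∑ i, x i * M i j := by
  induction x using Finsupp.induction_linear with
  | zero => simp
  | add x y hx hy =>
    rw [map_add]
    simp [add_mul, Finset.sum_add_distrib, ← hx, ← hy]
  | single i y =>
    induction y using MonoidAlgebra.induction_linear with
    | zero => simp
    | add x y hx hy =>
      rw [Finsupp.single_add, map_add]
      simp [add_mul, Finset.sum_add_distrib, ← hx, ← hy]
    | single g n =>
      have := Representation.freeLift_single_single (freeRep s).ρ i g n
        fun i => Finsupp.equivFunOnFinite.symm (M i)
      refine (DFunLike.congr_fun this j).trans ?_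
      refine (congrArg (n • ·) (free_apply g _ j)).trans ?_
      rw [Finset.sum_eq_single i (fun k _ hk => by simp [Finsupp.single_eq_of_ne hk]) (by simp)]
      have hn : MonoidAlgebra.single g n = n • (MonoidAlgebra.single g 1 : GroupRing) := by
        rw [MonoidAlgebra.smul_single, smul_eq_mul, mul_one]
      rw [hn, Finsupp.single_eq_same, smul_mul_assoc]
      rfl

/-- The trivial representation of `Q₈` on `ℤ`. -/
noncomputable abbrev trivialRep : Rep ℤ (QuaternionGroup 2) :=
  Rep.trivial ℤ (QuaternionGroup 2) ℤ

lemma freeLift_trivialRep_apply {r : ℕ} (c : Fin r → ℤ) (x : Fin r →₀ GroupRing) :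
    (Rep.freeLift ℤ (QuaternionGroup 2) trivialRep c).hom x = ∑ j, ε (x j) * c j := by
  induction x using Finsupp.induction_linear with
  | zero => simp
  | add x y hx hy =>
    rw [map_add]
    simp [add_mul, Finset.sum_add_distrib, ← hx, ← hy]
  | single i y =>
    induction y using MonoidAlgebra.induction_linear with
    | zero => simp
    | add x y hx hy =>
      rw [Finsupp.single_add, map_add]
      simp [add_mul, Finset.sum_add_distrib, ← hx, ← hy]
    | single g n =>
      refine (Representation.freeLift_single_single trivialRep.ρ i g n c).trans ?_
      rw [Finset.sum_eq_single i (fun k _ hk => by simp [Finsupp.single_eq_of_ne hk]) (by simp)]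
      simp [ε]

/-- The augmentation of the free `ℤ[Q₈]`-module of rank one. -/
noncomputable def augmentation : freeRep 1 ⟶ trivialRep :=
  Rep.freeLift ℤ (QuaternionGroup 2) trivialRep 1

lemma augmentation_apply (x : Fin 1 →₀ GroupRing) : augmentation.hom x = ε (x 0) :=
  (freeLift_trivialRep_apply 1 x).trans (by simp)

/-- The terms of the periodic free resolution of `ℤ` over `ℤ[Q₈]`. -/
noncomputable def resolutionX : ℕ → Rep ℤ (QuaternionGroup 2)
  | 0 => freeRep 1
  | 1 => freeRep 2
  | 2 => freeRep 2
  | 3 => freeRep 1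
  | n + 4 => resolutionX n

/-- The differentials of the periodic free resolution of `ℤ` over `ℤ[Q₈]`. -/
noncomputable def resolutionD : ∀ n : ℕ, resolutionX (n + 1) ⟶ resolutionX n
  | 0 => ofMatrix M₀
  | 1 => ofMatrix M₁
  | 2 => ofMatrix M₂
  | 3 => ofMatrix M₃
  | n + 4 => resolutionD n

lemma ofMatrix_zero {r s : ℕ} : ofMatrix (0 : Matrix (Fin r) (Fin s) GroupRing) = 0 := by
  refine Rep.hom_ext (Representation.IntertwiningMap.ext
    (LinearMap.ext fun x => Finsupp.ext fun j => ?_))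
  exact (ofMatrix_apply 0 x j).trans (by simp)

lemma ofMatrix_comp {r s t : ℕ} (M : Matrix (Fin r) (Fin s) GroupRing)
    (N : Matrix (Fin s) (Fin t) GroupRing) : ofMatrix M ≫ ofMatrix N = ofMatrix (M * N) := by
  refine Rep.hom_ext (Representation.IntertwiningMap.ext
    (LinearMap.ext fun (x : Fin r →₀ GroupRing) => Finsupp.ext fun j => ?_))
  refine (ofMatrix_apply N _ j).trans (Eq.trans ?_ (ofMatrix_apply (M * N) x j).symm)
  refine (Finset.sum_congr rfl fun i _ => congrArg (· * N i j) (ofMatrix_apply M x i)).trans ?_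
  simp only [Matrix.mul_apply, Finset.sum_mul, Finset.mul_sum, mul_assoc]
  exact Finset.sum_comm

lemma resolutionD_comp : ∀ n : ℕ, resolutionD (n + 1) ≫ resolutionD n = 0
  | 0 => (ofMatrix_comp M₁ M₀).trans ((congrArg ofMatrix M₁_mul_M₀).trans ofMatrix_zero)
  | 1 => (ofMatrix_comp M₂ M₁).trans ((congrArg ofMatrix M₂_mul_M₁).trans ofMatrix_zero)
  | 2 => (ofMatrix_comp M₃ M₂).trans ((congrArg ofMatrix M₃_mul_M₂).trans ofMatrix_zero)
  | 3 => (ofMatrix_comp M₀ M₃).trans ((congrArg ofMatrix M₀_mul_M₃).trans ofMatrix_zero)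
  | n + 4 => resolutionD_comp n

lemma ofMatrix_comp_augmentation : ofMatrix M₀ ≫ augmentation = 0 := by
  refine Rep.hom_ext (Representation.IntertwiningMap.ext
    (LinearMap.ext fun (x : Fin 2 →₀ GroupRing) => ?_))
  refine (augmentation_apply _).trans ((congrArg ε (ofMatrix_apply M₀ x 0)).trans ?_)
  simp [M₀, ε_α, ε_β]

/-- A short complex of representations is exact if it is elementwise exact. -/
lemma shortComplex_exact {k G : Type} [CommRing k] [Group G] {X Y Z : Rep.{0} k G}
    (f : X ⟶ Y) (g : Y ⟶ Z) (w : f ≫ g = 0) (h : ∀ y : Y, g.hom y = 0 → ∃ x : X, f.hom x = y) :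
    (ShortComplex.mk f g w).Exact := by
  apply (forget₂ _ (ModuleCat k)).reflects_exact_of_faithful
  rw [ShortComplex.moduleCat_exact_iff]
  exact h

lemma exact_M₀_augmentation :
    (ShortComplex.mk _ _ ofMatrix_comp_augmentation).Exact := by
  refine shortComplex_exact _ _ _ fun (y : Fin 1 →₀ GroupRing) hy => ?_
  rw [augmentation_apply] at hy
  obtain ⟨u, v, h⟩ := exists_of_ε_eq_zero hy
  refine ⟨Finsupp.equivFunOnFinite.symm ![u, v], Finsupp.ext fun j => ?_⟩
  refine (ofMatrix_apply _ _ _).trans ?_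
  fin_cases j
  simpa [M₀] using! h

lemma ofMatrix_exact {r s t : ℕ} (M : Matrix (Fin r) (Fin s) GroupRing)
    (N : Matrix (Fin s) (Fin t) GroupRing) (w : ofMatrix M ≫ ofMatrix N = 0)
    (h : ∀ y : Fin s → GroupRing, (∀ j, ∑ i, y i * N i j = 0) →
      ∃ x : Fin r → GroupRing, ∀ j, ∑ i, x i * M i j = y j) :
    (ShortComplex.mk _ _ w).Exact := by
  refine shortComplex_exact _ _ _ fun (y : Fin s →₀ GroupRing) hy => ?_
  obtain ⟨x, hx⟩ := h y fun j =>
    (ofMatrix_apply N y j).symm.trans (DFunLike.congr_fun (F := Fin t →₀ GroupRing) hy j)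
  exact ⟨Finsupp.equivFunOnFinite.symm x, Finsupp.ext fun j => (ofMatrix_apply _ _ _).trans (hx j)⟩

lemma resolution_exact : ∀ n : ℕ, (ShortComplex.mk _ _ (resolutionD_comp n)).Exact
  | 0 => ofMatrix_exact M₁ M₀ _ fun y hy => by
    obtain ⟨u, v, h, h'⟩ := exists_of_mul_add_mul_eq_zero (by simpa [M₀] using hy)
    exact ⟨![u, v], Fin.forall_fin_two.2 ⟨by simpa [M₁] using h, by simpa [M₁] using h'⟩⟩
  | 1 => ofMatrix_exact M₂ M₁ _ fun y hy => by
    obtain ⟨u, h, h'⟩ := exists_of_mul_one_add_eq_zero (by simpa [M₁] using hy 0)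
      (by simpa [M₁] using hy 1)
    exact ⟨![u], Fin.forall_fin_two.2 ⟨by simpa [M₂] using h, by simpa [M₂] using h'⟩⟩
  | 2 => ofMatrix_exact M₃ M₂ _ fun y hy => by
    obtain ⟨u, h⟩ := exists_of_mul_eq_zero (by simpa [M₂] using hy 0) (by simpa [M₂] using hy 1)
    exact ⟨![u], by simpa [M₃] using h⟩
  | 3 => ofMatrix_exact M₀ M₃ _ fun y hy => by
    obtain ⟨u, v, h⟩ := exists_of_ε_eq_zero (ε_eq_zero_of_mul_ν_eq_zero (by simpa [M₃] using hy))
    exact ⟨![u, v], by simpa [M₀] using h⟩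
  | n + 4 => resolution_exact n

lemma resolution_projective : ∀ n : ℕ, Projective (resolutionX n)
  | 0 | 1 | 2 | 3 => Rep.free_projective
  | n + 4 => resolution_projective n

lemma augmentation_surjective : Function.Surjective augmentation.hom := fun n =>
  ⟨Finsupp.single 0 (n • 1 : GroupRing), (augmentation_apply _).trans (by simp)⟩

/-- A projective resolution assembled from exact sequences of projective objects. -/
noncomputable def projectiveResolutionOf {C : Type*} [Category* C] [Abelian C] {A : C} (X : ℕ → C)
    (d : ∀ n, X (n + 1) ⟶ X n) (hd : ∀ n, d (n + 1) ≫ d n = 0) (p : X 0 ⟶ A) (hp : d 0 ≫ p = 0)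
    [Epi p] (hX : ∀ n, Projective (X n)) (exact : ∀ n, (ShortComplex.mk _ _ (hd n)).Exact)
    (exact₀ : (ShortComplex.mk _ _ hp).Exact) : ProjectiveResolution A where
  complex := .of X d hd
  projective := hX
  π := ((ChainComplex.of X d hd).toSingle₀Equiv A).symm
    ⟨p, (congrArg (· ≫ p) (ChainComplex.of_d ..)).trans hp⟩
  quasiIso.quasiIsoAt
    | 0 => by
      rw [ChainComplex.quasiIsoAt₀_iff, ShortComplex.quasiIso_iff_of_zeros' _ rfl rfl rfl]
      constructor
      · refine (ShortComplex.exact_iff_of_iso (ShortComplex.isoMk (S₁ := .mk (d 0) p hp)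
          (Iso.refl (X 1)) (Iso.refl (X 0)) (Iso.refl A) ?_ ?_)).1 exact₀
        · exact (Category.id_comp _).trans
            ((ChainComplex.of_d X d 0).trans (Category.comp_id _).symm)
        · refine (Category.id_comp _).trans (Eq.trans ?_ (Category.comp_id _).symm)
          exact ChainComplex.toSingle₀Equiv_symm_apply_f_zero ..
      · have : Epi ((((ChainComplex.of X d hd).toSingle₀Equiv A).symm
            ⟨p, (congrArg (· ≫ p) (ChainComplex.of_d ..)).trans hp⟩).f 0) := by
          rw [ChainComplex.toSingle₀Equiv_symm_apply_f_zero]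
          exact ‹Epi p›
        exact this
    | m + 1 => by
      rw [quasiIsoAt_iff_exactAt' (hL := ChainComplex.exactAt_succ_single_obj ..),
          HomologicalComplex.exactAt_iff' _ (m + 2) (m + 1) m (by simp) (by simp)]
      refine (ShortComplex.exact_iff_of_iso (ShortComplex.isoMk (S₁ := .mk _ _ (hd m))
        (Iso.refl (X (m + 2))) (Iso.refl (X (m + 1))) (Iso.refl (X m)) ?_ ?_)).1 (exact m)
      · exact (Category.id_comp _).trans
          ((ChainComplex.of_d X d (m + 1)).trans (Category.comp_id _).symm)
      · exact (Category.id_comp _).trans ((ChainComplex.of_d X d m).trans (Category.comp_id _).symm)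

/-- The periodic free resolution of `ℤ` over `ℤ[Q₈]`. -/
noncomputable def resolution :
    ProjectiveResolution (Rep.trivial ℤ (QuaternionGroup 2) ℤ) :=
  have : @Epi (Rep ℤ (QuaternionGroup 2)) _ (resolutionX 0) _ augmentation :=
    (Rep.epi_iff_surjective _).2 augmentation_surjective
  projectiveResolutionOf resolutionX resolutionD resolutionD_comp augmentation
    ofMatrix_comp_augmentation resolution_projective resolution_exact exact_M₀_augmentation

/-- The short complex obtained by applying `Hom(-, ℤ)` to a short complex of representations. -/
noncomputable def homShortComplex {X Y Z : Rep.{0} ℤ (QuaternionGroup 2)} (f : X ⟶ Y) (g : Y ⟶ Z)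
    (w : f ≫ g = 0) : ShortComplex (ModuleCat ℤ) :=
  .mk (ModuleCat.ofHom (Linear.leftComp ℤ trivialRep g))
    (ModuleCat.ofHom (Linear.leftComp ℤ trivialRep f)) <|
    ModuleCat.hom_ext <| LinearMap.ext fun (φ : Z ⟶ trivialRep) =>
      (Category.assoc f g φ).symm.trans ((congrArg (· ≫ φ) w).trans Limits.zero_comp)

/-- The cohomology of `Q₈` in positive degree `n + 1` is computed by the resolution. -/
noncomputable def groupCohomologySuccIso (n : ℕ) : groupCohomology trivialRep (n + 1) ≅
    (homShortComplex (resolutionD (n + 1)) (resolutionD n) (resolutionD_comp n)).homology :=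
  groupCohomologyIso trivialRep (n + 1) resolution ≪≫ ShortComplex.homologyMapIso
    (HomologicalComplex.isoSc' _ n (n + 1) (n + 2) (by simp) (by simp) ≪≫ ShortComplex.isoMk
      (S₁ := (resolution.complex.linearYonedaObj ℤ trivialRep).sc' n (n + 1) (n + 2))
      (S₂ := homShortComplex (resolutionD (n + 1)) (resolutionD n) (resolutionD_comp n))
      (Iso.refl (ModuleCat.of ℤ (resolutionX n ⟶ trivialRep)))
      (Iso.refl (ModuleCat.of ℤ (resolutionX (n + 1) ⟶ trivialRep)))
      (Iso.refl (ModuleCat.of ℤ (resolutionX (n + 2) ⟶ trivialRep)))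
      ((Category.id_comp _).trans (Eq.trans
        (congrArg (fun f => ModuleCat.ofHom (Linear.leftComp ℤ trivialRep f))
          (ChainComplex.of_d resolutionX resolutionD n).symm) (Category.comp_id _).symm))
      ((Category.id_comp _).trans (Eq.trans
        (congrArg (fun f => ModuleCat.ofHom (Linear.leftComp ℤ trivialRep f))
          (ChainComplex.of_d resolutionX resolutionD (n + 1)).symm) (Category.comp_id _).symm)))

/-- `Hom(ℤ[Q₈]ʳ, ℤ)` is `ℤʳ`. -/
noncomputable abbrev homEquiv (r : ℕ) : (freeRep r ⟶ trivialRep) ≃ₗ[ℤ] (Fin r → ℤ) :=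
  Rep.freeLiftLEquiv ℤ (QuaternionGroup 2) (Fin r) trivialRep

lemma ofMatrix_comp_homEquiv_symm {r s : ℕ} (M : Matrix (Fin r) (Fin s) GroupRing)
    (c : Fin s → ℤ) :
    ofMatrix M ≫ (homEquiv s).symm c = (homEquiv r).symm ((M.map ε).mulVec c) := by
  refine Rep.hom_ext (Representation.IntertwiningMap.ext
    (LinearMap.ext fun (x : Fin r →₀ GroupRing) => ?_))
  refine (freeLift_trivialRep_apply c _).trans
    (Eq.trans ?_ (freeLift_trivialRep_apply ((M.map ε).mulVec c) x).symm)
  refine (Finset.sum_congr rfl fun j _ =>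
    congrArg (fun y => ε y * c j) (ofMatrix_apply M x j)).trans ?_
  simp only [map_sum, map_mul, Matrix.mulVec, dotProduct, Matrix.map_apply, Finset.sum_mul,
    Finset.mul_sum, mul_assoc]
  exact Finset.sum_comm

/-- The homology of a short complex of modules is any quotient of the cycles by the boundaries. -/
lemma nonempty_homology_equiv {R : Type} [CommRing R] (S : ShortComplex (ModuleCat.{0} R))
    {T : Type} [AddCommGroup T] [Module R T] (π : S.X₂ →ₗ[R] T)
    (surj : ∀ t, ∃ x, S.g.hom x = 0 ∧ π x = t)
    (ker : ∀ x, S.g.hom x = 0 → (π x = 0 ↔ ∃ y, S.f.hom y = x)) :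
    Nonempty (S.homology ≃ₗ[R] T) := by
  let π' : LinearMap.ker S.g.hom →ₗ[R] T := π ∘ₗ Submodule.subtype _
  have surj' : Function.Surjective π' := fun t =>
    let ⟨x, hx, hxt⟩ := surj t
    ⟨⟨x, hx⟩, hxt⟩
  have ker' : LinearMap.range S.moduleCatToCycles = LinearMap.ker π' := by
    ext ⟨x, hx⟩
    exact (exists_congr fun y => Subtype.ext_iff).trans (ker x hx).symm
  exact ⟨S.moduleCatHomologyIso.toLinearEquiv ≪≫ₗ Submodule.quotEquivOfEq _ _ ker' ≪≫ₗ
    LinearMap.quotKerEquivOfSurjective π' surj'⟩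

lemma nonempty_homShortComplex_homology_equiv {r s t : ℕ} {M : Matrix (Fin r) (Fin s) GroupRing}
    {N : Matrix (Fin s) (Fin t) GroupRing} (w : ofMatrix M ≫ ofMatrix N = 0)
    {T : Type} [AddCommGroup T] (π : (Fin s → ℤ) →ₗ[ℤ] T)
    (surj : ∀ t, ∃ v, (M.map ε).mulVec v = 0 ∧ π v = t)
    (ker : ∀ v, (M.map ε).mulVec v = 0 → (π v = 0 ↔ ∃ u, (N.map ε).mulVec u = v)) :
    Nonempty ((homShortComplex _ _ w).homology ≃ₗ[ℤ] T) := by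
  have hg (v : Fin s → ℤ) : ofMatrix M ≫ (homEquiv s).symm v = 0 ↔ (M.map ε).mulVec v = 0 := by
    rw [ofMatrix_comp_homEquiv_symm, LinearEquiv.map_eq_zero_iff]
  refine nonempty_homology_equiv (homShortComplex _ _ w) (π ∘ₗ (homEquiv s).toLinearMap)
    (fun t => ?_) (fun (φ : freeRep s ⟶ trivialRep) hφ => ?_)
  · obtain ⟨v, hv, rfl⟩ := surj t
    exact ⟨(homEquiv s).symm v, (hg v).2 hv, congrArg π ((homEquiv s).apply_symm_apply v)⟩
  · obtain ⟨v, rfl⟩ := (homEquiv s).symm.surjective φ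
    refine (((congrArg (π · = 0) ((homEquiv s).apply_symm_apply v)).to_iff.trans
      (ker v ((hg v).1 hφ)))).trans
      ((homEquiv t).symm.surjective.exists.trans (exists_congr fun u => ?_)).symm
    exact (congrArg (· = (homEquiv s).symm v) (ofMatrix_comp_homEquiv_symm N u)).to_iff.trans
      (homEquiv s).symm.injective.eq_iff

lemma map_ε_M₀ : M₀.map ε = 0 := by
  ext i j
  fin_cases i <;> fin_cases j <;> simp [M₀, ε_α, ε_β]

lemma map_ε_M₁ : M₁.map ε = !![2, -2; 2, 0] := by
  ext i j
  fin_cases i <;> fin_cases j <;> simp [M₁, ε_α, ε_β]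

lemma map_ε_M₂ : M₂.map ε = 0 := by
  ext i j
  fin_cases i; fin_cases j <;> simp [M₂, ε_α, ε_β]

lemma map_ε_M₃ : M₃.map ε = !![8] := by
  ext i j
  fin_cases i; fin_cases j; simp [M₃, ν, ε_α, ε_β]

lemma nonempty_homology_resolution_one :
    Nonempty ((homShortComplex _ _ (resolutionD_comp 0)).homology ≃ₗ[ℤ] PUnit) :=
  nonempty_homShortComplex_homology_equiv (M := M₁) (N := M₀) _ 0 (fun _ => ⟨0, by simp⟩)
    fun v hv => by
      rw [map_ε_M₁] at hv
      have hv0 : 2 * v 0 + -(2 * v 1) = 0 := by simpa using! congrFun hv 0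
      have h0 : v 0 = 0 := by simpa using! congrFun hv 1
      have h1 : v 1 = 0 := by omega
      simp only [LinearMap.zero_apply, true_iff]
      exact ⟨0, (Matrix.mulVec_zero _).trans (funext (Fin.forall_fin_two.2 ⟨h0.symm, h1.symm⟩))⟩

lemma nonempty_homology_resolution_three :
    Nonempty ((homShortComplex _ _ (resolutionD_comp 2)).homology ≃ₗ[ℤ] PUnit) :=
  nonempty_homShortComplex_homology_equiv (M := M₃) (N := M₂) _ 0 (fun _ => ⟨0, by simp⟩)
    fun v hv => by
      rw [map_ε_M₃] at hv
      have h0 : v 0 = 0 := by simpa using! congrFun hv 0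
      simp only [LinearMap.zero_apply, true_iff]
      exact ⟨0, (Matrix.mulVec_zero _).trans (funext (Fin.forall_fin_one.2 h0.symm))⟩

lemma nonempty_homology_resolution_four :
    Nonempty ((homShortComplex _ _ (resolutionD_comp 3)).homology ≃ₗ[ℤ] ZMod 8) := by
  refine nonempty_homShortComplex_homology_equiv (M := M₀) (N := M₃) _
    ((Int.castAddHom (ZMod 8)).toIntLinearMap ∘ₗ LinearMap.proj 0) (fun t => ?_) (fun v _ => ?_)
  · obtain ⟨n, rfl⟩ := ZMod.intCast_surjective t
    exact ⟨fun _ => n, by rw [map_ε_M₀, Matrix.zero_mulVec], rfl⟩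
  · rw [map_ε_M₃]
    refine (ZMod.intCast_zmod_eq_zero_iff_dvd (v 0) 8).trans ⟨?_, ?_⟩
    · rintro ⟨c, hc⟩
      exact ⟨fun _ => c, funext (Fin.forall_fin_one.2 (by simpa using! hc.symm))⟩
    · rintro ⟨u, rfl⟩
      exact ⟨u 0, by simp [Matrix.vecHead]⟩

lemma nonempty_homology_resolution_two :
    Nonempty ((homShortComplex _ _ (resolutionD_comp 1)).homology ≃ₗ[ℤ] ZMod 2 × ZMod 2) := by
  let q : ℤ →ₗ[ℤ] ZMod 2 := (Int.castAddHom (ZMod 2)).toIntLinearMap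
  refine nonempty_homShortComplex_homology_equiv (M := M₂) (N := M₁) _
    ((q ∘ₗ LinearMap.proj 0).prod (q ∘ₗ LinearMap.proj 1)) (fun t => ?_) (fun v _ => ?_)
  · obtain ⟨m, hm⟩ := ZMod.intCast_surjective t.1
    obtain ⟨n, hn⟩ := ZMod.intCast_surjective t.2
    exact ⟨![m, n], by rw [map_ε_M₂, Matrix.zero_mulVec], Prod.ext hm hn⟩
  · rw [map_ε_M₁]
    refine Prod.mk_eq_zero.trans (((ZMod.intCast_zmod_eq_zero_iff_dvd (v 0) 2).and
      (ZMod.intCast_zmod_eq_zero_iff_dvd (v 1) 2)).trans ⟨?_, ?_⟩)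
    · rintro ⟨⟨c, hc⟩, ⟨d, hd⟩⟩
      refine ⟨![d, d - c], funext (Fin.forall_fin_two.2 ⟨?_, ?_⟩)⟩
      · simp [hc]
        ring
      · simp [hd, mul_comm]
    · rintro ⟨u, rfl⟩
      exact ⟨⟨u 0 - u 1, by simp [Matrix.vecHead, Matrix.vecTail]; ring⟩,
        ⟨u 0, by simp [Matrix.vecHead]⟩⟩

/-- Integral cohomology of `Q₈` is periodic of period four in positive degrees. -/
lemma nonempty_groupCohomology_equiv {T : Type} [AddCommGroup T] (n : ℕ)
    (h : Nonempty ((homShortComplex _ _ (resolutionD_comp n)).homology ≃ₗ[ℤ] T)) :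
    ∀ k : ℕ, Nonempty (groupCohomology trivialRep (n + 4 * k + 1) ≃ₗ[ℤ] T) := by
  have h' : ∀ k : ℕ,
      Nonempty ((homShortComplex _ _ (resolutionD_comp (n + 4 * k))).homology ≃ₗ[ℤ] T) :=
    Nat.rec h fun _ => id
  exact fun k => (h' k).map ((groupCohomologySuccIso _).toLinearEquiv ≪≫ₗ ·)

end QuaternionGroup

/-- The integral cohomology of the quaternion group `Q₈ = QuaternionGroup 2`. -/
theorem cohomology_of_quaternion_group :
    Nonempty ((groupCohomology (Rep.trivial ℤ (QuaternionGroup 2) ℤ) 0) ≃ₗ[ℤ] ℤ) ∧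
    (∀ i : ℕ, Odd i → Subsingleton (groupCohomology (Rep.trivial ℤ (QuaternionGroup 2) ℤ) i)) ∧
    (∀ i : ℕ, i % 4 = 2 →
      Nonempty ((groupCohomology (Rep.trivial ℤ (QuaternionGroup 2) ℤ) i) ≃ₗ[ℤ]
        (ZMod 2 × ZMod 2))) ∧
    (∀ i : ℕ, 0 < i → i % 4 = 0 →
      Nonempty ((groupCohomology (Rep.trivial ℤ (QuaternionGroup 2) ℤ) i) ≃ₗ[ℤ] ZMod 8)) := by
  refine ⟨⟨(groupCohomology.H0IsoOfIsTrivial _).toLinearEquiv⟩, fun i hi => ?_, fun i hi => ?_,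
    fun i hi hi' => ?_⟩
  · have hi' : i % 4 = 1 ∨ i % 4 = 3 := by grind
    obtain hi' | hi' := hi'
    · obtain ⟨k, rfl⟩ : ∃ k, i = 0 + 4 * k + 1 := ⟨i / 4, by omega⟩
      obtain ⟨e⟩ := QuaternionGroup.nonempty_groupCohomology_equiv 0
        QuaternionGroup.nonempty_homology_resolution_one k
      exact e.toEquiv.subsingleton
    · obtain ⟨k, rfl⟩ : ∃ k, i = 2 + 4 * k + 1 := ⟨i / 4, by omega⟩
      obtain ⟨e⟩ := QuaternionGroup.nonempty_groupCohomology_equiv 2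
        QuaternionGroup.nonempty_homology_resolution_three k
      exact e.toEquiv.subsingleton
  · obtain ⟨k, rfl⟩ : ∃ k, i = 1 + 4 * k + 1 := ⟨i / 4, by omega⟩
    exact QuaternionGroup.nonempty_groupCohomology_equiv 1
      QuaternionGroup.nonempty_homology_resolution_two k
  · obtain ⟨k, rfl⟩ : ∃ k, i = 3 + 4 * k + 1 := ⟨i / 4 - 1, by omega⟩
    exact QuaternionGroup.nonempty_groupCohomology_equiv 3
      QuaternionGroup.nonempty_homology_resolution_four k
end

section
/- Let p and q be primes and let D = ⟨s,t | s^p = t^q = 1, t s t⁻¹ = s^r⟩ = ℤ/p ⋊ ℤ/q, where r has multiplicative order q modulo p. Let ℤ[ξ_p] = ℤ[X]/(Φ_p(X)) be the ring of cyclotomic integers, regarded as a D-module where s acts by multiplication by ξ_p (the class of X) and t acts by the ring automorphism sending ξ_p to ξ_p^r. Then for every integer i > 0, the p-primary component of H^i(D; ℤ[ξ_p]) is isomorphic to the p-primary component of H^{i+1}(D; ℤ) (with ℤ a trivial D-module). -/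
/-- A homomorphism whose kernel and cokernel are killed by an integer prime to `p` identifies
the `p`-primary components of its source and target. -/
theorem AddCommGroup.nonempty_primaryComponent_addEquiv {A B : Type*} [AddCommGroup A]
    [AddCommGroup B] {p m : ℕ} (hpm : m.Coprime p) (f : A →+ B)
    (hker : ∀ a, f a = 0 → m • a = 0) (hcoker : ∀ b, ∃ a, f a = m • b) :
    Nonempty (AddCommGroup.primaryComponent A p ≃+ AddCommGroup.primaryComponent B p) := by
  let F : AddCommGroup.primaryComponent A p →+ AddCommGroup.primaryComponent B p :=
    (f.comp (AddCommGroup.primaryComponent A p).subtype).codRestrict _ fun a ↦ by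
      obtain ⟨k, hk⟩ := AddCommGroup.mem_primaryComponent.1 a.2
      exact AddCommGroup.mem_primaryComponent.2 ⟨k, by simp [← map_nsmul, hk]⟩
  refine ⟨AddEquiv.ofBijective F ⟨(injective_iff_map_eq_zero F).2 fun a ha ↦ ?_, fun b ↦ ?_⟩⟩
  · obtain ⟨k, hk⟩ := AddCommGroup.mem_primaryComponent.1 a.2
    have h := Nat.dvd_gcd (addOrderOf_dvd_of_nsmul_eq_zero (hker a (congrArg Subtype.val ha)))
      (addOrderOf_dvd_of_nsmul_eq_zero hk)
    rw [Nat.Coprime.pow_right k hpm, Nat.dvd_one, AddMonoid.addOrderOf_eq_one_iff] at h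
    exact Subtype.ext h
  · obtain ⟨k, hk⟩ := AddCommGroup.mem_primaryComponent.1 b.2
    obtain ⟨a, ha⟩ := hcoker b
    obtain ⟨u, v, huv⟩ := Nat.isCoprime_iff_coprime.2
      ((hpm.mul_left hpm).pow_right k : (m * m).Coprime (p ^ k))
    have hb : (u * ((m * m : ℕ) : ℤ)) • (b : B) = b := by
      have h := congrArg (· • (b : B)) huv
      rwa [add_smul, mul_smul v, natCast_zsmul (b : B) (p ^ k), hk, smul_zero, add_zero,
        one_smul] at h
    refine ⟨⟨u • m • a, AddCommGroup.mem_primaryComponent.2 ⟨k, ?_⟩⟩, Subtype.ext ?_⟩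
    · have := hker (p ^ k • a) (by rw [map_nsmul, ha, smul_comm, hk, smul_zero])
      rw [smul_comm, smul_comm (p ^ k) m, this, smul_zero]
    · change f (u • m • a) = b
      rw [map_zsmul, map_nsmul, ha, ← mul_smul m, ← natCast_zsmul, ← mul_smul, hb]

section

open CategoryTheory

variable {k G X : Type} [CommRing k] [Group G] [MulAction G X]

variable (k G X) in
/-- The permutation representation of `G` on the functions from a `G`-set to `k`. -/
def Representation.ofMulActionFun : Representation k G (X → k) where
  toFun g := LinearMap.funLeft k k (g⁻¹ • ·)
  map_one' := by ext; simp [LinearMap.funLeft]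
  map_mul' _ _ := by ext; simp [LinearMap.funLeft, mul_smul]

theorem Representation.ofMulActionFun_apply (g : G) (f : X → k) (x : X) :
    Representation.ofMulActionFun k G X g f x = f (g⁻¹ • x) := rfl

variable (k G) in
/-- The module coinduced from `k` along the trivial subgroup. -/
noncomputable abbrev Rep.coindBot : Rep k G :=
  Rep.coind (⊥ : Subgroup G).subtype (Rep.trivial k (⊥ : Subgroup G) k)

theorem groupCohomology.isZero_coindBot (n : ℕ) :
    Limits.IsZero (groupCohomology (Rep.coindBot k G) (n + 1)) :=
  (isZero_groupCohomology_succ_of_subsingleton _ n).of_iso (coindIso _ _)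

variable (k G) in
/-- Functions on the orbit of `x₀`, pulled back to `G`. -/
def Representation.toCoindBot (x₀ : X) : (ofMulActionFun k G X).IntertwiningMap
    (coind (⊥ : Subgroup G).subtype (Rep.trivial k (⊥ : Subgroup G) k).ρ) where
  toFun f := ⟨fun g ↦ f (g⁻¹ • x₀), fun g h ↦ by
    obtain rfl : g = 1 := Subsingleton.elim _ _
    simp⟩
  map_add' _ _ := rfl
  map_smul' _ _ := rfl
  isIntertwining' g := by
    ext f h
    exact congrArg f (by simp [mul_smul])

open scoped Classical in
variable (k G) in
/-- Functions on the finite group `G`, summed over the fibres of `g ↦ g⁻¹ • x₀`. -/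
noncomputable def Representation.ofCoindBot [Fintype G] (x₀ : X) :
    (coind (⊥ : Subgroup G).subtype (Rep.trivial k (⊥ : Subgroup G) k).ρ).IntertwiningMap
    (ofMulActionFun k G X) where
  toFun f x := ∑ g : G with g⁻¹ • x₀ = x, f.1 g
  map_add' _ _ := by ext; simp [Finset.sum_add_distrib]
  map_smul' _ _ := by ext; simp [Finset.mul_sum]
  isIntertwining' g := by
    ext f x
    simp only [LinearMap.coe_comp, Function.comp_apply]
    refine Finset.sum_equiv (Equiv.mulRight g) (fun h ↦ ?_) fun _ _ ↦ rfl
    simp [mul_smul]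

theorem Representation.ofCoindBot_toCoindBot [Fintype G] {x₀ : X} {m : ℕ}
    (hm : ∀ x : X, Nat.card {g : G // g⁻¹ • x₀ = x} = m) (f : X → k) :
    ofCoindBot k G x₀ (toCoindBot k G x₀ f) = m • f := by
  classical
  ext x
  change ∑ g : G with g⁻¹ • x₀ = x, f (g⁻¹ • x₀) = _
  rw [Finset.sum_congr rfl fun g hg ↦ by rw [(Finset.mem_filter.1 hg).2], Finset.sum_const,
    ← Fintype.card_subtype, ← Nat.card_eq_fintype_card, hm, Pi.smul_apply]

theorem groupCohomology.map_nsmul_id (A : Rep k G) (m n : ℕ) :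
    map (MonoidHom.id G) (m • 𝟙 A) n = m • 𝟙 (groupCohomology A n) := by
  have h := (cochainsFunctor k G ⋙ HomologicalComplex.homologyFunctor _ _ n).map_nsmul
    (f := 𝟙 A) (n := m)
  rw [CategoryTheory.Functor.map_id] at h
  exact h

/-- If `G` acts transitively on `X` with point stabilizers of order `m`, then `m` kills the
cohomology of the module of functions on `X`. -/
theorem groupCohomology.nsmul_eq_zero_of_ofMulActionFun [Finite G] {x₀ : X} {m : ℕ}
    (hm : ∀ x : X, Nat.card {g : G // g⁻¹ • x₀ = x} = m) (n : ℕ)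
    (a : groupCohomology (Rep.of (Representation.ofMulActionFun k G X)) (n + 1)) :
    m • a = 0 := by
  have := Fintype.ofFinite G
  have hcomp : m • 𝟙 (Rep.of (Representation.ofMulActionFun k G X)) =
      Rep.ofHom (Representation.toCoindBot k G x₀) ≫ Rep.ofHom (Representation.ofCoindBot k G x₀) :=
    Rep.hom_ext <| Representation.IntertwiningMap.ext <| LinearMap.ext fun f ↦
      (Representation.ofCoindBot_toCoindBot hm f).symm
  have hmap := map_nsmul_id (Rep.of (Representation.ofMulActionFun k G X)) m (n + 1)
  rw [hcomp, map_id_comp, (isZero_coindBot n).eq_of_tgt (map _ _ _) 0, Limits.zero_comp] at hmap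
  exact (congrArg (fun F ↦ F.hom a) hmap).symm

theorem Rep.shortExact_of_exact {S : ShortComplex (Rep k G)} (hf : Function.Injective S.f.hom)
    (hfg : Function.Exact S.f.hom S.g.hom) (hg : Function.Surjective S.g.hom) : S.ShortExact where
  exact := by
    apply (forget₂ _ (ModuleCat k)).reflects_exact_of_faithful
    exact (ShortComplex.ShortExact.moduleCat_exact_iff_function_exact _).2 hfg
  mono_f := (Rep.mono_iff_injective _).2 hf
  epi_g := (Rep.epi_iff_surjective _).2 hg

theorem groupCohomology.nonempty_primaryComponent_addEquiv {S : ShortComplex (Rep k G)}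
    (hS : S.ShortExact) {p m i : ℕ} (hpm : m.Coprime p)
    (h : ∀ a : groupCohomology S.X₂ i, m • a = 0)
    (h' : ∀ a : groupCohomology S.X₂ (i + 1), m • a = 0) :
    Nonempty (AddCommGroup.primaryComponent (groupCohomology S.X₃ i) p ≃+
      AddCommGroup.primaryComponent (groupCohomology S.X₁ (i + 1)) p) := by
  refine AddCommGroup.nonempty_primaryComponent_addEquiv hpm
    (δ hS i (i + 1) rfl).hom.toAddMonoidHom (fun a ha ↦ ?_) fun b ↦ ?_
  · obtain ⟨c, rfl⟩ := ((ShortComplex.ShortExact.moduleCat_exact_iff_function_exact _).1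
      (mapShortComplex₃_exact hS rfl) a).1 ha
    exact (map_nsmul (mapShortComplex₃ hS rfl).f.hom m c).symm.trans
      ((congrArg (mapShortComplex₃ hS rfl).f.hom (h c)).trans (map_zero _))
  · refine ((ShortComplex.ShortExact.moduleCat_exact_iff_function_exact _).1
      (mapShortComplex₁_exact hS rfl) (m • b)).1 ?_
    exact (map_nsmul (mapShortComplex₁ hS rfl).g.hom m b).trans (h' _)

section

variable {N H : Type} [Group N] [Group H] (φ : H →* MulAut N)

/-- The action of `N ⋊ H` on `N` in which `N` acts by translations and `H` through `φ`. -/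
abbrev SemidirectProduct.mulActionLeft : MulAction (N ⋊[φ] H) N where
  smul g x := g.left * φ g.right x
  one_smul x := by change 1 * φ 1 x = x; simp
  mul_smul g h x := by
    change (g * h).left * φ (g * h).right x = g.left * φ g.right (h.left * φ h.right x)
    simp [mul_assoc]

attribute [local instance] SemidirectProduct.mulActionLeft

variable {φ}

theorem SemidirectProduct.smul_def (g : N ⋊[φ] H) (x : N) : g • x = g.left * φ g.right x := rfl

theorem SemidirectProduct.card_inv_smul_eq (x₀ x : N) :
    Nat.card {g : N ⋊[φ] H // g⁻¹ • x₀ = x} = Nat.card H := by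
  refine Nat.card_congr
    { toFun g := g.1.right
      invFun h := ⟨⟨x₀ * (φ h x)⁻¹, h⟩, ?_⟩
      left_inv g := ?_
      right_inv h := rfl }
  · rw [inv_smul_eq_iff, smul_def]
    simp
  · obtain ⟨g, hg⟩ := g
    rw [inv_smul_eq_iff, smul_def] at hg
    ext <;> simp [hg]

theorem SemidirectProduct.mul_inl (g : N ⋊[φ] H) (x : N) :
    g * inl x = inl (g • x) * inr g.right := by
  ext <;> simp [smul_def]

variable {A : Type} [AddCommGroup A] [Module k A] (ρ : Representation k (N ⋊[φ] H) A)

/-- A vector fixed by `H` extends to a map from the functions on `N`. -/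
def Representation.ofMulActionFunLift [Fintype N] (v : A)
    (hv : ∀ h, ρ (SemidirectProduct.inr h) v = v) :
    (ofMulActionFun k (N ⋊[φ] H) N).IntertwiningMap ρ where
  toLinearMap := Fintype.linearCombination k fun x ↦ ρ (SemidirectProduct.inl x) v
  isIntertwining' g := by
    ext x
    simp only [LinearMap.coe_comp, Function.comp_apply, Fintype.linearCombination_apply, map_sum,
      map_smul, ofMulActionFun_apply]
    refine (Fintype.sum_equiv (MulAction.toPerm g) _ _ fun y ↦ ?_).symm
    rw [MulAction.toPerm_apply, inv_smul_smul, ← Module.End.mul_apply, ← map_mul,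
      SemidirectProduct.mul_inl, map_mul, Module.End.mul_apply, hv]

variable (k G X) in
/-- The inclusion of the constant functions. -/
def Representation.constFun : (trivial k G k).IntertwiningMap (ofMulActionFun k G X) where
  toFun := Function.const X
  map_add' _ _ := rfl
  map_smul' _ _ := rfl
  isIntertwining' _ := rfl

end

end

section

open Polynomial

theorem ZMod.sum_val {p : ℕ} [NeZero p] {A : Type*} [AddCommMonoid A] (f : ℕ → A) :
    ∑ x : ZMod p, f x.val = ∑ n ∈ Finset.range p, f n :=
  Finset.sum_nbij' ZMod.val (fun n ↦ (n : ZMod p)) (by simp [ZMod.val_lt]) (by simp) (by simp)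
    (fun n hn ↦ ZMod.val_cast_of_lt (by simpa using hn)) (by simp)

/-- The only linear relations between the powers `1, ξ, …, ξᵖ⁻¹` of a primitive `p`-th root of
unity are the multiples of `1 + ξ + ⋯ + ξᵖ⁻¹ = 0`. -/
theorem Polynomial.sum_smul_mk_X_pow_eq_zero_iff {p : ℕ} [Fact p.Prime] (f : ZMod p → ℤ) :
    ∑ x, f x • Ideal.Quotient.mk (Ideal.span {cyclotomic p ℤ}) X ^ x.val = 0 ↔
      ∃ c, ∀ x, f x = c := by
  have hmk : ∑ x, f x • Ideal.Quotient.mk (Ideal.span {cyclotomic p ℤ}) X ^ x.val =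
      Ideal.Quotient.mk (Ideal.span {cyclotomic p ℤ}) (∑ x, f x • X ^ x.val) := by
    simp
  have hcyc : cyclotomic p ℤ = ∑ x : ZMod p, X ^ x.val := by
    rw [cyclotomic_prime, ZMod.sum_val (fun n ↦ (X : ℤ[X]) ^ n)]
  have hcoeff (g : ZMod p → ℤ) (y : ZMod p) :
      (∑ x, g x • (X : ℤ[X]) ^ x.val).coeff y.val = g y := by
    simp [coeff_X_pow, (ZMod.val_injective p).eq_iff]
  rw [hmk, Ideal.Quotient.eq_zero_iff_mem, Ideal.mem_span_singleton]
  constructor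
  · rintro ⟨Q, hQ⟩
    have hdeg : Q.natDegree = 0 := by
      rcases eq_or_ne Q 0 with rfl | hQ0
      · simp
      have h1 := (cyclotomic.monic p ℤ).natDegree_mul' hQ0
      have h2 : (∑ x, f x • (X : ℤ[X]) ^ x.val).natDegree ≤ p - 1 :=
        natDegree_sum_le_of_forall_le _ _ fun x _ ↦ (natDegree_smul_le _ _).trans <| by
          rw [natDegree_X_pow]
          exact Nat.le_sub_one_of_lt x.val_lt
      rw [hQ, h1, natDegree_cyclotomic, Nat.totient_prime Fact.out] at h2
      omega
    obtain ⟨c, rfl⟩ := natDegree_eq_zero.1 hdeg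
    refine ⟨c, fun x ↦ ?_⟩
    have hx := hcoeff (fun _ ↦ 1) x
    simp only [one_smul, ← hcyc] at hx
    rw [← hcoeff f x, hQ, coeff_mul_C, hx, one_mul]
  · rintro ⟨c, hc⟩
    simp only [hc, ← Finset.smul_sum, ← hcyc]
    exact dvd_smul_of_dvd c dvd_rfl

end

section

variable (p q r : ℕ) (φ : Multiplicative (ZMod q) →* MulAut (Multiplicative (ZMod p)))

local notation "D" => Multiplicative (ZMod p) ⋊[φ] Multiplicative (ZMod q)
local notation "Zxi" => Polynomial ℤ ⧸ Ideal.span {Polynomial.cyclotomic p ℤ}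
local notation "xi" => Ideal.Quotient.mk (Ideal.span {Polynomial.cyclotomic p ℤ}) Polynomial.X

/-- For `D = ℤ/p ⋊ ℤ/q = ⟨s,t | sᵖ = tᵠ = 1, tst⁻¹ = sʳ⟩` and the `D`-module `ℤ[ξ_p]` on
which `s` acts by multiplication by `ξ_p` and `t` by the ring endomorphism `ξ_p ↦ ξ_pʳ`, the
`p`-primary part of `H^i(D; ℤ[ξ_p])` is that of `H^{i+1}(D; ℤ)`, for every `i > 0`. -/
theorem primary_component_cohomology_cyclotomic
    [Fact p.Prime] (hq : q.Prime) (hr : orderOf (r : ZMod p) = q)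
    (hφ : ∀ x : Multiplicative (ZMod p), φ (Multiplicative.ofAdd (1 : ZMod q)) x = x ^ r)
    (ρ : Representation ℤ (Multiplicative (ZMod p) ⋊[φ] Multiplicative (ZMod q)) Zxi)
    (hs : ∀ v : Zxi, ρ (SemidirectProduct.inl (Multiplicative.ofAdd (1 : ZMod p))) v = xi * v)
    (ht : ∃ τ : Zxi →+* Zxi, τ xi = xi ^ r ∧
      ∀ v : Zxi, ρ (SemidirectProduct.inr (Multiplicative.ofAdd (1 : ZMod q))) v = τ v)
    (i : ℕ) (hi : 0 < i) :
    Nonempty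
      (AddCommGroup.primaryComponent (groupCohomology (Rep.of ρ) i) p ≃+
        AddCommGroup.primaryComponent (groupCohomology (Rep.trivial ℤ D ℤ) (i + 1)) p) := by
  let := SemidirectProduct.mulActionLeft φ
  have : NeZero q := ⟨hq.ne_zero⟩
  have : Finite D := Finite.of_equiv _ SemidirectProduct.equivProd.symm
  have hqp : q.Coprime p := by
    have hr0 : (r : ZMod p) ≠ 0 := fun h ↦ hq.ne_zero <| by rw [← hr, h, orderOf_zero]
    have hdvd := ZMod.orderOf_dvd_card_sub_one hr0
    rw [hr] at hdvd
    have hp := (Fact.out : p.Prime).two_le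
    have hle := Nat.le_of_dvd (by omega) hdvd
    exact (Nat.coprime_primes hq Fact.out).2 (by omega)
  have hxi (n : ℕ) : ρ (SemidirectProduct.inl (Multiplicative.ofAdd (n : ZMod p))) 1 = xi ^ n := by
    induction n with
    | zero => simp
    | succ n ih =>
      rw [Nat.cast_succ, add_comm, ofAdd_add, map_mul, map_mul, Module.End.mul_apply, ih, hs,
        pow_succ']
  have hone (b : Multiplicative (ZMod q)) : ρ (SemidirectProduct.inr b) 1 = 1 := by
    obtain ⟨τ, -, hτ⟩ := ht
    have hb (n : ℕ) : ρ (SemidirectProduct.inr (Multiplicative.ofAdd (n : ZMod q))) 1 = 1 := by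
      induction n with
      | zero => simp
      | succ n ih =>
        rw [Nat.cast_succ, add_comm, ofAdd_add, map_mul, map_mul, Module.End.mul_apply, ih, hτ,
          map_one]
    simpa using hb b.toAdd.val
  let g := Representation.ofMulActionFunLift ρ 1 hone
  have hg (f : Multiplicative (ZMod p) → ℤ) :
      g f = ∑ x : ZMod p, f (Multiplicative.ofAdd x) • xi ^ x.val := by
    refine (Fintype.linearCombination_apply ℤ _ f).trans ?_
    refine Fintype.sum_equiv Multiplicative.toAdd _ _ fun x ↦ ?_
    rw [← hxi, ZMod.natCast_zmod_val, ofAdd_toAdd]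
  have hexact : Function.Exact (Representation.constFun ℤ D (Multiplicative (ZMod p))) g := by
    intro f
    rw [hg, Polynomial.sum_smul_mk_X_pow_eq_zero_iff]
    exact ⟨fun ⟨c, hc⟩ ↦ ⟨c, funext fun x ↦ (hc x.toAdd).symm⟩,
      fun ⟨c, hc⟩ ↦ ⟨c, fun x ↦ congr_fun hc.symm _⟩⟩
  have hsurj : Function.Surjective g := by
    intro v
    obtain ⟨P, rfl⟩ := Ideal.Quotient.mk_surjective v
    induction P using Polynomial.induction_on' with
    | add P Q hP hQ =>
      obtain ⟨a, ha⟩ := hP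
      obtain ⟨b, hb⟩ := hQ
      exact ⟨a + b, by rw [map_add, map_add, ha, hb]⟩
    | monomial n a =>
      refine ⟨Pi.single (Multiplicative.ofAdd (n : ZMod p)) a, ?_⟩
      refine (Fintype.linearCombination_apply_single ℤ _ _ a).trans ?_
      rw [hxi, ← Polynomial.C_mul_X_pow_eq_monomial, map_mul, map_pow, zsmul_eq_mul]
      simp
  let S : CategoryTheory.ShortComplex (Rep ℤ D) :=
    .mk (Rep.ofHom (Representation.constFun ℤ D (Multiplicative (ZMod p)))) (Rep.ofHom g)
      (Rep.hom_ext <| Representation.IntertwiningMap.ext <| LinearMap.ext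
        hexact.apply_apply_eq_zero)
  have hS : S.ShortExact :=
    Rep.shortExact_of_exact (S := S) (Function.const_injective) hexact hsurj
  have hkill (n : ℕ) (a : groupCohomology S.X₂ (n + 1)) : q • a = 0 :=
    groupCohomology.nsmul_eq_zero_of_ofMulActionFun (x₀ := 1)
      (fun x ↦ by rw [SemidirectProduct.card_inv_smul_eq]; simp) n a
  obtain ⟨j, rfl⟩ := Nat.exists_eq_add_one.2 hi
  exact groupCohomology.nonempty_primaryComponent_addEquiv hS hqp (hkill j) (hkill (j + 1))

end
end
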